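/- Let k be a field of characteristic zero, R = k[x_1, …, x_d] a polynomial ring of dimension d > 1, m = (x_1, …, x_d) its maximal homogeneous ideal, and I ⊆ R a homogeneous ideal. Then the limit lim_{n→∞} λ(H^0_m(R/I^n))/n^d exists (as a real number), and it equals lim_{n→∞} λ(Ext^d_R(R/I^n, R(−d)))/n^d. -/

import Mathlib

/-!
STATEMENT 0: Let `k` be a field of characteristic zero, `R = k[x_1, …, x_d]` a polynomial
ring of dimension `d > 1`, `m = (x_1, …, x_d)` its maximal homogeneous ideal, and `I ⊆ R` a
homogeneous ideal.  Then the limit `lim_{n→∞} λ(H⁰_m(R/Iⁿ))/n^d` exists (as a real number),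
and it equals `lim_{n→∞} λ(Ext^d_R(R/Iⁿ, R(−d)))/n^d`.

Here `H⁰_m(M) = {x ∈ M | mᵏ x = 0 for some k}` is the zeroth local cohomology module,
`λ` is the length, which (for these modules) equals the dimension as a `k`-vector space,
and `R(−d)` is the twisted module, which as an abstract `R`-module is just `R`
(the twist does not change lengths of the Ext modules).
-/

open MvPolynomial Filter

/-- The zeroth local cohomology module `H⁰_J(M) = {x ∈ M | ∃ n, Jⁿ • x = 0}`,
realized as the submodule of `J`-power-torsion elements of `M`. -/
noncomputable def H0 {R M : Type*} [CommRing R] [AddCommGroup M] [Module R M]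
    (J : Ideal R) : Submodule R M :=
  ⨆ n : ℕ, Submodule.torsionBySet R M (J ^ n : Ideal R)

/-- The length of a module over a `k`-algebra, computed as its `k`-vector-space dimension. -/
noncomputable def kLength (k : Type*) {R : Type*} [Field k] [CommRing R] [Algebra k R]
    (M : ModuleCat R) : ℕ :=
  Module.finrank k ((ModuleCat.restrictScalars (algebraMap k R)).obj M)

attribute [local instance] MvPolynomial.gradedAlgebra


section CountLimit
open MeasureTheory Set

/-- the half-open cube of side `1/n` at the lattice point `a / n` -/
def epsCube {d : ℕ} (n : ℕ) (a : Fin d → ℕ) : Set (Fin d → ℝ) :=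
  Set.pi Set.univ fun i => Set.Ico ((a i : ℝ) / n) (((a i : ℝ) + 1) / n)

lemma mem_epsCube {d : ℕ} {n : ℕ} (hn : 0 < n) {a : Fin d → ℕ} {x : Fin d → ℝ} :
    x ∈ epsCube n a ↔ ∀ i, (a i : ℝ) ≤ n * x i ∧ n * x i < a i + 1 := by
  have hn' : (0 : ℝ) < n := by exact_mod_cast hn
  simp only [epsCube, Set.mem_pi, Set.mem_univ, true_implies, Set.mem_Ico]
  refine forall_congr' fun i => ?_
  rw [div_le_iff₀' hn', lt_div_iff₀' hn']

lemma volume_epsCube {d : ℕ} {n : ℕ} (hn : 0 < n) (a : Fin d → ℕ) :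
    volume (epsCube n a) = ENNReal.ofReal ((1 / (n : ℝ)) ^ d) := by
  have hn' : (0 : ℝ) < n := by exact_mod_cast hn
  rw [epsCube, Real.volume_pi_Ico]
  have : ∀ i : Fin d, ((a i : ℝ) + 1) / n - (a i : ℝ) / n = 1 / n := by
    intro i; field_simp; ring
  simp only [this, Finset.prod_const, Finset.card_univ, Fintype.card_fin]
  rw [ENNReal.ofReal_pow (by positivity)]

lemma measurableSet_epsCube {d : ℕ} (n : ℕ) (a : Fin d → ℕ) : MeasurableSet (epsCube n a) :=
  MeasurableSet.univ_pi fun _ => measurableSet_Ico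

lemma epsCube_disjoint {d : ℕ} {n : ℕ} (hn : 0 < n) {a b : Fin d → ℕ} (hab : a ≠ b) :
    Disjoint (epsCube n a) (epsCube n b) := by
  rw [Set.disjoint_left]
  intro x hx hy
  rw [mem_epsCube hn] at hx hy
  apply hab
  funext i
  have h1 := hx i
  have h2 := hy i
  have h3 : (a i : ℝ) < b i + 1 := lt_of_le_of_lt h1.1 h2.2
  have h4 : (b i : ℝ) < a i + 1 := lt_of_le_of_lt h2.1 h1.2
  have h5 : a i < b i + 1 := by exact_mod_cast h3
  have h6 : b i < a i + 1 := by exact_mod_cast h4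
  omega

lemma finite_count {d : ℕ} (A : Set (Fin d → ℕ)) (c : ℕ) :
    {a : Fin d → ℕ | a ∈ A ∧ ∑ i, a i ≤ c}.Finite := by
  refine Set.Finite.subset (Set.finite_Iic (fun _ => c : Fin d → ℕ)) ?_
  rintro a ⟨-, h⟩ i
  exact (Finset.single_le_sum (f := a) (fun _ _ => Nat.zero_le _) (Finset.mem_univ i)).trans h

lemma exists_strict_below {d : ℕ} {T : Set (Fin d → ℝ)} {x : Fin d → ℝ} (hx : x ∈ interior T) :
    ∃ ε > 0, (fun i => x i - ε) ∈ T := by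
  have hc : Continuous (fun (ε : ℝ) (i : Fin d) => x i - ε) := by fun_prop
  have h0 : (fun (i : Fin d) => x i - 0) ∈ interior T := by simpa using hx
  have := (isOpen_interior.preimage hc).mem_nhds h0
  obtain ⟨δ, hδ, h⟩ := Metric.mem_nhds_iff.1 this
  refine ⟨δ / 2, by positivity, ?_⟩
  have : δ / 2 ∈ Metric.ball (0 : ℝ) δ := by
    rw [Metric.mem_ball, Real.dist_eq, sub_zero, abs_of_pos (by positivity)]; linarith
  exact interior_subset (h this)

theorem count_limit {d : ℕ} (hd : 0 < d) (A : ℕ → Set (Fin d → ℕ)) (hup : ∀ n, IsUpperSet (A n))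
    (hadd : ∀ n m a b, a ∈ A n → b ∈ A m → a + b ∈ A (n + m)) (hne : ∀ n, (A n).Nonempty)
    (c : ℕ) :
    ∃ L : ℝ, Tendsto (fun n : ℕ =>
      (Set.ncard {a : Fin d → ℕ | a ∈ A n ∧ ∑ i, a i ≤ c * n} : ℝ) / (n : ℝ) ^ d)
      atTop (nhds L) := by
  classical
  set U : Set (Fin d → ℝ) := {x | ∃ n : ℕ, 0 < n ∧ ∃ a ∈ A n, ∀ i, (a i : ℝ) ≤ n * x i} with hU
  have hUup : IsUpperSet U := by
    rintro x y hxy ⟨n, hn, a, ha, h⟩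
    exact ⟨n, hn, a, ha, fun i => (h i).trans (mul_le_mul_of_nonneg_left (hxy i) (by positivity))⟩
  set T : Set (Fin d → ℝ) := {x | (c : ℝ) ≤ ∑ i, x i} with hT
  have hTup : IsUpperSet T := by
    intro x y hxy hx
    exact le_trans hx (Finset.sum_le_sum fun i _ => hxy i)
  set S : ℕ → Set (Fin d → ℝ) := fun n =>
    ⋃ a ∈ (finite_count (A n) (c * n)).toFinset, epsCube n a with hS
  have hSvol : ∀ n : ℕ, 0 < n → volume (S n) =
      ENNReal.ofReal ((Set.ncard {a : Fin d → ℕ | a ∈ A n ∧ ∑ i, a i ≤ c * n} : ℝ) /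
        (n : ℝ) ^ d) := by
    intro n hn
    rw [hS]
    simp only
    rw [measure_biUnion_finset (fun a _ b _ hab => epsCube_disjoint hn hab)
      (fun a _ => measurableSet_epsCube n a)]
    simp only [volume_epsCube hn, Finset.sum_const]
    rw [Set.ncard_eq_toFinset_card _ (finite_count (A n) (c * n)), nsmul_eq_mul,
      ← ENNReal.ofReal_natCast, ← ENNReal.ofReal_mul (by positivity)]
    congr 1
    rw [one_div, inv_pow, div_eq_mul_inv]
  have hmemS : ∀ n : ℕ, 0 < n → ∀ x : Fin d → ℝ, (∀ i, 0 ≤ x i) →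
      (x ∈ S n ↔ (fun i => ⌊n * x i⌋₊) ∈ A n ∧ ∑ i, ⌊n * x i⌋₊ ≤ c * n) := by
    intro n hn x hx
    simp only [hS, Set.mem_iUnion, Set.Finite.mem_toFinset, Set.mem_setOf_eq, exists_prop]
    constructor
    · rintro ⟨a, ⟨ha, hs⟩, hxa⟩
      rw [mem_epsCube hn] at hxa
      have : a = fun i => ⌊n * x i⌋₊ := by
        funext i
        symm
        rw [Nat.floor_eq_iff (mul_nonneg (by positivity) (hx i))]
        exact hxa i
      subst this
      exact ⟨ha, hs⟩
    · rintro ⟨ha, hs⟩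
      refine ⟨_, ⟨ha, hs⟩, ?_⟩
      rw [mem_epsCube hn]
      intro i
      exact ⟨Nat.floor_le (mul_nonneg (by positivity) (hx i)), Nat.lt_floor_add_one _⟩
  have hSnn : ∀ n : ℕ, 0 < n → ∀ x ∈ S n, x ∈ U ∧ (∀ i, 0 ≤ x i) ∧ (∀ i, x i ≤ c + 1) := by
    intro n hn x hx
    have hn' : (0 : ℝ) < n := by exact_mod_cast hn
    have hn1 : (1 : ℝ) ≤ n := by exact_mod_cast hn
    simp only [hS, Set.mem_iUnion, Set.Finite.mem_toFinset, Set.mem_setOf_eq, exists_prop] at hx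
    obtain ⟨a, ⟨ha, hs⟩, hxa⟩ := hx
    rw [mem_epsCube hn] at hxa
    refine ⟨⟨n, hn, a, ha, fun i => (hxa i).1⟩, fun i => ?_, fun i => ?_⟩
    · have := (hxa i).1
      by_contra! hneg
      have h2 : (n : ℝ) * x i < 0 := mul_neg_of_pos_of_neg hn' hneg
      have h3 : (0 : ℝ) ≤ a i := by positivity
      linarith
    · have h1 : a i ≤ c * n :=
        (Finset.single_le_sum (f := a) (fun _ _ => Nat.zero_le _) (Finset.mem_univ i)).trans hs
      have h2 : (a i : ℝ) ≤ c * n := by exact_mod_cast h1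
      have h3 := (hxa i).2
      by_contra! hneg
      have : (n : ℝ) * (c + 1) < n * x i := by gcongr
      nlinarith
  set G : Set (Fin d → ℝ) := interior U ∩ interior Tᶜ with hG
  have key : Tendsto (fun n => volume (S n)) atTop (nhds (volume G)) := by
    refine tendsto_measure_of_ae_tendsto_indicator (B := Set.Icc (fun _ => 0) (fun _ => (c : ℝ) + 1))
      atTop
      (isOpen_interior.measurableSet.inter isOpen_interior.measurableSet)
      (fun n => Finset.measurableSet_biUnion _ fun a _ => measurableSet_epsCube n a)
      measurableSet_Icc ?_ ?_ ?_
    · exact (isCompact_Icc.measure_lt_top).ne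
    · filter_upwards [eventually_gt_atTop 0] with n hn x hx
      obtain ⟨_, h1, h2⟩ := hSnn n hn x hx
      exact ⟨h1, h2⟩
    · have h1 : ∀ᵐ x : Fin d → ℝ, x ∉ frontier U := measure_eq_zero_iff_ae_notMem.1 hUup.null_frontier
      have h2 : ∀ᵐ x : Fin d → ℝ, x ∉ frontier T := measure_eq_zero_iff_ae_notMem.1 hTup.null_frontier
      filter_upwards [h1, h2] with x hxU hxT
      by_cases hxi : x ∈ interior U
      swap
      · have hxnU : x ∉ U := fun h => hxU ⟨subset_closure h, hxi⟩
        filter_upwards [eventually_gt_atTop 0] with n hn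
        exact ⟨fun h => absurd (hSnn n hn x h).1 hxnU, fun h => absurd h.1 hxi⟩
      obtain ⟨ε, hε, n₀, hn₀, a, ha, hax⟩ := exists_strict_below hxi
      have hn₀' : (0 : ℝ) < n₀ := by exact_mod_cast hn₀
      have hxnn : ∀ i, 0 ≤ x i := by
        intro i
        have h3 : (0 : ℝ) ≤ a i := by positivity
        have h4 : 0 ≤ (n₀ : ℝ) * (x i - ε) := h3.trans (hax i)
        have h5 : 0 ≤ x i - ε := by
          by_contra! hneg
          exact absurd (mul_neg_of_pos_of_neg hn₀' hneg) (not_lt.2 h4)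
        linarith
      by_cases hxT' : x ∈ T
      · have hxTi : x ∈ interior T := by
          by_contra h
          exact hxT ⟨subset_closure hxT', h⟩
        obtain ⟨η, hη, hηT⟩ := exists_strict_below hxTi
        have hsum : (c : ℝ) + d * η ≤ ∑ i, x i := by
          have : (c : ℝ) ≤ ∑ i, (x i - η) := hηT
          simp only [Finset.sum_sub_distrib, Finset.sum_const, Finset.card_univ, Fintype.card_fin,
            nsmul_eq_mul] at this
          linarith
        obtain ⟨N, hN⟩ := exists_nat_gt (1 / η)
        filter_upwards [eventually_gt_atTop 0, eventually_ge_atTop N] with n hn hnN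
        refine ⟨fun h => ?_, fun h => absurd hxT' (interior_subset h.2)⟩
        exfalso
        rw [hmemS n hn x hxnn] at h
        have h1 : (∑ i, (⌊n * x i⌋₊ : ℝ)) ≤ c * n := by exact_mod_cast h.2
        have h2 : ∑ i, ((n : ℝ) * x i - 1) < ∑ i, (⌊n * x i⌋₊ : ℝ) := by
          refine Finset.sum_lt_sum_of_nonempty ?_ fun i _ => Nat.sub_one_lt_floor _
          exact ⟨⟨0, hd⟩, Finset.mem_univ _⟩
        simp only [Finset.sum_sub_distrib, Finset.sum_const, Finset.card_univ, Fintype.card_fin,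
            nsmul_eq_mul, ← Finset.mul_sum] at h2
        have hnη : 1 < n * η := by
          have : (1 / η : ℝ) < n := hN.trans_le (by exact_mod_cast hnN)
          rwa [div_lt_iff₀ hη] at this
        have hd' : (0 : ℝ) < d := by exact_mod_cast hd
        have hn' : (0 : ℝ) < n := by exact_mod_cast hn
        have h3 : (n : ℝ) * (c + d * η) ≤ n * ∑ i, x i := by gcongr
        nlinarith
      · have hxG : x ∈ G := by
          refine ⟨hxi, ?_⟩
          rw [interior_compl]
          intro h
          exact hxT ⟨h, fun h' => hxT' (interior_subset h')⟩
        choose b hb using hne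
        obtain ⟨B, hB⟩ : ∃ B : ℕ, ∀ r < n₀, ∀ i, b r i ≤ B := by
          refine ⟨∑ r ∈ Finset.range n₀, ∑ i, b r i, fun r hr i => ?_⟩
          calc b r i ≤ ∑ i, b r i :=
                Finset.single_le_sum (f := b r) (fun _ _ => Nat.zero_le _) (Finset.mem_univ i)
            _ ≤ _ := Finset.single_le_sum (f := fun r => ∑ i, b r i) (fun _ _ => Nat.zero_le _)
                (Finset.mem_range.2 hr)
        obtain ⟨N, hN⟩ := exists_nat_gt ((B : ℝ) / ε)
        filter_upwards [eventually_gt_atTop 0, eventually_ge_atTop N] with n hn hnN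
        refine ⟨fun _ => hxG, fun _ => ?_⟩
        have hn' : (0 : ℝ) < n := by exact_mod_cast hn
        have hxnT : ∑ i, x i < c := not_le.1 hxT'
        rw [hmemS n hn x hxnn]
        constructor
        · have hmul : ∀ q : ℕ, 0 < q → q • a ∈ A (q * n₀) := by
            intro q hq
            induction q, hq using Nat.le_induction with
            | base => simpa using ha
            | succ q hq ih =>
              have := hadd _ _ _ _ ih ha
              rw [succ_nsmul, Nat.succ_mul]; exact this
          have hmem : (n / n₀) • a + b (n % n₀) ∈ A n := by
            rcases Nat.eq_zero_or_pos (n / n₀) with h0 | h0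
            · rw [h0, zero_smul, zero_add]
              have : n % n₀ = n := Nat.mod_eq_of_lt ((Nat.div_eq_zero_iff_lt hn₀).1 h0)
              rw [this]; exact hb n
            · have := hadd _ _ _ _ (hmul _ h0) (hb (n % n₀))
              rwa [mul_comm, Nat.div_add_mod] at this
          refine hup n ?_ hmem
          intro i
          refine Nat.le_floor ?_
          have hq : ((n / n₀ : ℕ) : ℝ) * n₀ ≤ n := by exact_mod_cast Nat.div_mul_le_self n n₀
          have hbB : (b (n % n₀) i : ℝ) ≤ B := by exact_mod_cast hB _ (Nat.mod_lt _ hn₀) i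
          have hBn : (B : ℝ) < n * ε := by
            have : (B : ℝ) / ε < n := hN.trans_le (by exact_mod_cast hnN)
            rwa [div_lt_iff₀ hε] at this
          have hxe : 0 ≤ x i - ε := by
            by_contra! hneg
            have h3 : (0 : ℝ) ≤ a i := by positivity
            exact absurd (mul_neg_of_pos_of_neg hn₀' hneg) (not_lt.2 (h3.trans (hax i)))
          simp only [Pi.add_apply, Pi.smul_apply, smul_eq_mul]
          push_cast
          calc ((n / n₀ : ℕ) : ℝ) * a i + b (n % n₀) i
              ≤ ((n / n₀ : ℕ) : ℝ) * (n₀ * (x i - ε)) + B := by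
                have := hax i
                gcongr
            _ = (((n / n₀ : ℕ) : ℝ) * n₀) * (x i - ε) + B := by ring
            _ ≤ n * (x i - ε) + B := by gcongr
            _ ≤ n * x i := by nlinarith
        · have : (∑ i, (⌊n * x i⌋₊ : ℝ)) ≤ c * n := by
            calc (∑ i, (⌊n * x i⌋₊ : ℝ)) ≤ ∑ i, (n : ℝ) * x i :=
                  Finset.sum_le_sum fun i _ => Nat.floor_le (mul_nonneg hn'.le (hxnn i))
              _ = n * ∑ i, x i := by rw [Finset.mul_sum]
              _ ≤ c * n := by nlinarith
          exact_mod_cast this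
  have hGfin : volume G ≠ ⊤ := by
    have hsub : G ⊆ Set.Icc (fun _ => 0) (fun _ => (c : ℝ)) := by
      intro x hx
      obtain ⟨n, hn, a, ha, hxa⟩ := interior_subset hx.1
      have hn' : (0 : ℝ) < n := by exact_mod_cast hn
      have hnn : ∀ i, 0 ≤ x i := by
        intro i
        by_contra! hneg
        have h3 : (0 : ℝ) ≤ a i := by positivity
        exact absurd (mul_neg_of_pos_of_neg hn' hneg) (not_lt.2 (h3.trans (hxa i)))
      have hs : ∑ i, x i < c := not_le.1 (interior_subset hx.2)
      exact ⟨hnn, fun i => (Finset.single_le_sum (f := x) (fun j _ => hnn j)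
        (Finset.mem_univ i)).trans hs.le⟩
    exact ((measure_mono hsub).trans_lt isCompact_Icc.measure_lt_top).ne
  refine ⟨(volume G).toReal, ?_⟩
  have := (ENNReal.tendsto_toReal hGfin).comp key
  refine this.congr' ?_
  filter_upwards [eventually_gt_atTop 0] with n hn
  rw [Function.comp_apply, hSvol n hn, ENNReal.toReal_ofReal (by positivity)]

end CountLimit
section Part2
variable {k : Type} [Field k] {d : ℕ}

/-- `Q` is closed under taking homogeneous components. -/
def HC (Q : Ideal (MvPolynomial (Fin d) k)) : Prop :=
  ∀ f ∈ Q, ∀ i, homogeneousComponent i f ∈ Q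

lemma hc_of_isHomogeneous {Q : Ideal (MvPolynomial (Fin d) k)}
    (h : Q.IsHomogeneous (homogeneousSubmodule (Fin d) k)) : HC Q :=
  fun _ hf i => homogeneousComponent_mem_of_mem h hf i

lemma HC.isHomogeneous {Q : Ideal (MvPolynomial (Fin d) k)} (h : HC Q) :
    Q.IsHomogeneous (homogeneousSubmodule (Fin d) k) := by
  intro i f hf
  have := h f hf i
  rw [← decomposition.decompose'_apply] at this
  exact this

lemma HC.mul {Q Q' : Ideal (MvPolynomial (Fin d) k)} (h : HC Q) (h' : HC Q') : HC (Q * Q') :=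
  hc_of_isHomogeneous (h.isHomogeneous.mul h'.isHomogeneous)

lemma HC.pow {Q : Ideal (MvPolynomial (Fin d) k)} (h : HC Q) (n : ℕ) : HC (Q ^ n) := by
  induction n with
  | zero =>
    intro f _ i
    simp
  | succ n ih => rw [pow_succ]; exact ih.mul h

lemma HC.inf {Q Q' : Ideal (MvPolynomial (Fin d) k)} (h : HC Q) (h' : HC Q') : HC (Q ⊓ Q') :=
  fun f hf i => ⟨h f hf.1 i, h' f hf.2 i⟩

lemma HC.sup {Q Q' : Ideal (MvPolynomial (Fin d) k)} (h : HC Q) (h' : HC Q') : HC (Q ⊔ Q') :=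
  hc_of_isHomogeneous (h.isHomogeneous.sup h'.isHomogeneous)

lemma HC.span_singleton {g : MvPolynomial (Fin d) k} {j : ℕ} (hg : g.IsHomogeneous j) :
    HC (Ideal.span {g}) := by
  apply hc_of_isHomogeneous
  apply Ideal.homogeneous_span
  rintro x rfl
  exact ⟨j, hg⟩

lemma comp_mul_hom {g : MvPolynomial (Fin d) k} {j : ℕ} (hg : g.IsHomogeneous j)
    (f : MvPolynomial (Fin d) k) (i : ℕ) :
    homogeneousComponent (j + i) (g * f) = g * homogeneousComponent i f := by
  have := DirectSum.coe_decompose_mul_add_of_left_mem (homogeneousSubmodule (Fin d) k)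
    (i := j) (j := i) (a := g) (b := f) hg
  rw [← decomposition.decompose'_apply, ← decomposition.decompose'_apply]
  exact this

lemma comp_mul_hom' {g : MvPolynomial (Fin d) k} {j : ℕ} (hg : g.IsHomogeneous j)
    (f : MvPolynomial (Fin d) k) (i : ℕ) (hi : j ≤ i) :
    homogeneousComponent i (f * g) = homogeneousComponent (i - j) f * g := by
  obtain ⟨c, rfl⟩ := Nat.exists_eq_add_of_le hi
  rw [mul_comm, comp_mul_hom hg, Nat.add_sub_cancel_left, mul_comm]

/-- saturation -/
def sat {R : Type*} [CommRing R] (J Q : Ideal R) : Ideal R where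
  carrier := {f | ∃ N, ∀ g ∈ J ^ N, g * f ∈ Q}
  zero_mem' := ⟨0, by simp⟩
  add_mem' := by
    rintro a b ⟨N, hN⟩ ⟨M, hM⟩
    refine ⟨N + M, fun g hg => ?_⟩
    rw [mul_add]
    exact Q.add_mem (hN g (Ideal.pow_le_pow_right (by omega) hg))
      (hM g (Ideal.pow_le_pow_right (by omega) hg))
  smul_mem' := by
    rintro c f ⟨N, hN⟩
    refine ⟨N, fun g hg => ?_⟩
    rw [smul_eq_mul, mul_left_comm]
    exact Q.mul_mem_left _ (hN g hg)

lemma mem_sat {R : Type*} [CommRing R] {J Q : Ideal R} {f : R} :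
    f ∈ sat J Q ↔ ∃ N, ∀ g ∈ J ^ N, g * f ∈ Q := Iff.rfl

lemma le_sat {R : Type*} [CommRing R] (J Q : Ideal R) : Q ≤ sat J Q :=
  fun _ hf => ⟨0, fun _ _ => Q.mul_mem_left _ hf⟩

lemma exists_pow_mul_le_of_le_sat {R : Type*} [CommRing R] {J Q Q' : Ideal R} (hQ : Q.FG)
    (h : Q ≤ sat J Q') : ∃ s, J ^ s * Q ≤ Q' := by
  obtain ⟨S, rfl⟩ := hQ
  have h1 : ∀ f ∈ S, ∃ N, ∀ g ∈ J ^ N, g * f ∈ Q' := fun f hf => h (Ideal.subset_span hf)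
  choose! N hN using h1
  refine ⟨S.sup N, ?_⟩
  rw [Ideal.mul_le]
  intro r hr f hf
  have : Ideal.span (S : Set R) ≤ Submodule.comap (LinearMap.mulLeft R r) Q' := by
    rw [Ideal.span_le]
    intro f hf
    exact hN f hf r (Ideal.pow_le_pow_right (Finset.le_sup hf) hr)
  exact this hf

lemma sat_sat {R : Type*} [CommRing R] [IsNoetherianRing R] (J Q : Ideal R) :
    sat J (sat J Q) = sat J Q := by
  apply le_antisymm _ (le_sat _ _)
  obtain ⟨s, hs⟩ := exists_pow_mul_le_of_le_sat (J := J) (Q' := Q)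
    (IsNoetherian.noetherian (sat J Q)) le_rfl
  rintro f ⟨N, hN⟩
  refine ⟨s + N, fun g hg => ?_⟩
  rw [pow_add] at hg
  have : J ^ s * J ^ N ≤ Submodule.comap (LinearMap.mulRight R f) Q := by
    rw [Ideal.mul_le]
    intro a ha b hb
    have := hs (Ideal.mul_mem_mul ha (hN b hb))
    simpa [mul_assoc] using this
  exact this hg

lemma hom_mem_pow_vars {a : MvPolynomial (Fin d) k} {j s : ℕ} (ha : a.IsHomogeneous j)
    (h : s ≤ j) : a ∈ idealOfVars (Fin d) k ^ s := by
  rw [mem_pow_idealOfVars_iff']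
  intro x hx
  exact ha.coeff_eq_zero (by omega)

lemma HC.sat {Q : Ideal (MvPolynomial (Fin d) k)} (h : HC Q) :
    HC (sat (idealOfVars (Fin d) k) Q) := by
  rintro f ⟨N, hN⟩ i
  refine ⟨N, fun g hg => ?_⟩
  rw [pow_idealOfVars_eq_span] at hg
  have : Ideal.span ((fun x => monomial x (1 : k)) '' (Finsupp.degree ⁻¹' {N})) ≤
      Submodule.comap (LinearMap.mulRight (MvPolynomial (Fin d) k) (homogeneousComponent i f)) Q := by
    rw [Ideal.span_le]
    rintro _ ⟨x, hx, rfl⟩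
    have hm : (monomial x (1 : k)).IsHomogeneous N := isHomogeneous_monomial _ hx
    have := h _ (hN _ (hom_mem_pow_vars hm le_rfl)) (N + i)
    rw [comp_mul_hom hm] at this
    exact this
  exact this hg

/-- `Q` is generated in degrees at most `D`. -/
def GenDeg (Q : Ideal (MvPolynomial (Fin d) k)) (D : ℕ) : Prop :=
  Q ≤ Ideal.span {g | g ∈ Q ∧ ∃ i ≤ D, g.IsHomogeneous i}

lemma HC.exists_genDeg {Q : Ideal (MvPolynomial (Fin d) k)} (h : HC Q) : ∃ D, GenDeg Q D := by
  obtain ⟨S, hS⟩ := IsNoetherian.noetherian Q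
  refine ⟨S.sup totalDegree, ?_⟩
  unfold GenDeg
  conv_lhs => rw [← hS]
  rw [Submodule.span_le]
  intro f hf
  have hfQ : f ∈ Q := hS ▸ Submodule.subset_span hf
  rw [← sum_homogeneousComponent f]
  refine Submodule.sum_mem _ fun i hi => Ideal.subset_span ⟨h f hfQ i, i, ?_,
    homogeneousComponent_isHomogeneous i f⟩
  have : f.totalDegree ≤ S.sup totalDegree := Finset.le_sup hf
  rw [Finset.mem_range] at hi
  omega

lemma GenDeg.mul {Q Q' : Ideal (MvPolynomial (Fin d) k)} {D D' : ℕ} (h : GenDeg Q D)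
    (h' : GenDeg Q' D') : GenDeg (Q * Q') (D + D') := by
  unfold GenDeg at *
  refine (Ideal.mul_mono h h').trans ?_
  rw [Ideal.span_mul_span', Ideal.span_le]
  rintro _ ⟨a, ⟨ha, i, hi, hai⟩, b, ⟨hb, j, hj, hbj⟩, rfl⟩
  exact Ideal.subset_span ⟨Ideal.mul_mem_mul ha hb, i + j, by omega, hai.mul hbj⟩

lemma GenDeg.pow {Q : Ideal (MvPolynomial (Fin d) k)} {D : ℕ} (h : GenDeg Q D) (n : ℕ) :
    GenDeg (Q ^ n) (D * n) := by
  induction n with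
  | zero =>
    unfold GenDeg
    intro f _
    have : (1 : MvPolynomial (Fin d) k) ∈ Ideal.span {g : MvPolynomial (Fin d) k |
      g ∈ Q ^ 0 ∧ ∃ i ≤ D * 0, g.IsHomogeneous i} :=
      Ideal.subset_span ⟨by simp, 0, by simp, isHomogeneous_one _ _⟩
    rw [(Ideal.eq_top_iff_one _).2 this]
    trivial
  | succ n ih => rw [pow_succ, Nat.mul_succ]; exact ih.mul h

lemma GenDeg.mem_pow_mul {Q : Ideal (MvPolynomial (Fin d) k)} {D : ℕ} (h : GenDeg Q D)
    {f : MvPolynomial (Fin d) k} (hf : f ∈ Q) {e s : ℕ} (hfe : f.IsHomogeneous e)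
    (he : D + s ≤ e) : f ∈ idealOfVars (Fin d) k ^ s * Q := by
  rw [← homogeneousComponent_eq_self hfe]
  obtain ⟨n, c, g, hg⟩ := Submodule.mem_span_set'.1 (h hf)
  rw [← hg, map_sum]
  refine Submodule.sum_mem _ fun j _ => ?_
  obtain ⟨hgQ, i, hi, hgi⟩ := (g j).2
  rw [smul_eq_mul, comp_mul_hom' hgi _ _ (by omega)]
  exact Ideal.mul_mem_mul (hom_mem_pow_vars (homogeneousComponent_isHomogeneous _ _) (by omega)) hgQ

theorem degree_bound (hd : 0 < d) {I : Ideal (MvPolynomial (Fin d) k)} (hI : HC I) :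
    ∃ c : ℕ, ∀ n ≥ 1, ∀ f ∈ sat (idealOfVars (Fin d) k) (I ^ n), ∀ e ≥ c * n,
      f.IsHomogeneous e → f ∈ I ^ n := by
  set m := idealOfVars (Fin d) k with hm
  set x : MvPolynomial (Fin d) k := X ⟨0, hd⟩ with hx
  have hxh : x.IsHomogeneous 1 := isHomogeneous_X _ _
  have hxm : x ∈ m := Ideal.subset_span ⟨_, rfl⟩
  let q : ℕ → Ideal (MvPolynomial (Fin d) k) := fun n => I ^ n ⊓ sat m (Ideal.span {x} * I ^ n)
  have hq : ∀ n, HC (q n) := fun n =>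
    (hI.pow n).inf (((HC.span_singleton hxh).mul (hI.pow n)).sat)
  have hsatmono : ∀ {A B : Ideal (MvPolynomial (Fin d) k)}, A ≤ B → sat m A ≤ sat m B := by
    rintro A B h f ⟨N, hN⟩
    exact ⟨N, fun g hg => h (hN g hg)⟩
  let F : Ideal.Filtration I (MvPolynomial (Fin d) k) :=
    { N := q
      mono := fun i => inf_le_inf (Ideal.pow_le_pow_right (by omega))
        (hsatmono (Ideal.mul_mono le_rfl (Ideal.pow_le_pow_right (by omega))))
      smul_le := fun i => by
        rw [smul_eq_mul, Ideal.mul_le]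
        rintro a ha b ⟨hb1, N, hN⟩
        refine ⟨?_, N, fun g hg => ?_⟩
        · change a * b ∈ I ^ (i + 1)
          rw [pow_succ']; exact Ideal.mul_mem_mul ha hb1
        · rw [pow_succ', mul_left_comm (Ideal.span {x}), mul_left_comm g]
          exact Ideal.mul_mem_mul ha (hN g hg) }
  have hst : F.Stable := by
    refine Ideal.Filtration.Stable.of_le (Ideal.stableFiltration_stable I ⊤) ?_
    intro n f hf
    have : f ∈ I ^ n := hf.1
    simpa [Ideal.stableFiltration] using this
  obtain ⟨n0, hn0⟩ := hst.exists_pow_smul_eq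
  have hA : ∀ n, ∃ t : ℕ, ∃ D s, t = D + s ∧ GenDeg (q n) D ∧
      m ^ s * q n ≤ Ideal.span {x} * I ^ n := by
    intro n
    obtain ⟨D, hD⟩ := (hq n).exists_genDeg
    obtain ⟨s, hs⟩ := exists_pow_mul_le_of_le_sat (J := m) (Q := q n)
      (Q' := Ideal.span {x} * I ^ n) (IsNoetherian.noetherian _) inf_le_right
    exact ⟨_, D, s, rfl, hD, hs⟩
  choose t ht using hA
  obtain ⟨δ, hδ⟩ := hI.exists_genDeg
  have hT : ∃ c : ℕ, ∀ n ≥ 1, ∀ f ∈ q n, ∀ e ≥ c * n, f.IsHomogeneous e →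
      f ∈ Ideal.span {x} * I ^ n := by
    refine ⟨δ + ∑ i ∈ Finset.range (n0 + 1), t i, fun n hn f hf e he hfe => ?_⟩
    have hle : ∀ i ≤ n0, t i ≤ ∑ i ∈ Finset.range (n0 + 1), t i := fun i hi =>
      Finset.single_le_sum (f := t) (fun _ _ => Nat.zero_le _) (Finset.mem_range.2 (by omega))
    rcases le_total n n0 with h | h
    · obtain ⟨D, s, h1, h2, h3⟩ := ht n
      have := hle n h
      exact h3 (h2.mem_pow_mul hf hfe (by nlinarith))
    · obtain ⟨p, rfl⟩ := Nat.exists_eq_add_of_le h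
      obtain ⟨D, s, h1, h2, h3⟩ := ht n0
      have h4 : q (n0 + p) = I ^ p * q n0 := hn0 p
      have h5 : GenDeg (q (n0 + p)) (δ * p + D) := by
        rw [h4]; exact (hδ.pow p).mul h2
      have := hle n0 le_rfl
      have h6 := h5.mem_pow_mul (s := s) hf hfe (by nlinarith)
      rw [h4, mul_left_comm] at h6
      have h7 := Ideal.mul_mono (le_refl (I ^ p)) h3 h6
      rwa [mul_left_comm, ← pow_add, add_comm p n0] at h7
  obtain ⟨c, hc⟩ := hT
  refine ⟨c, fun n hn => ?_⟩
  have key : ∀ s : ℕ, ∀ f ∈ sat m (I ^ n), ∀ e ≥ c * n, f.IsHomogeneous e → x ^ s * f ∈ I ^ n →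
      f ∈ I ^ n := by
    intro s
    induction s with
    | zero => intro f _ e _ _ h; simpa using h
    | succ s ih =>
      intro f hf e he hfe h
      have h1 : x * f ∈ I ^ n := by
        refine ih (x * f) (Ideal.mul_mem_left _ _ hf) (1 + e) (by omega) (hxh.mul hfe) ?_
        rwa [← mul_assoc, ← pow_succ]
      have h2 : x * f ∈ q n := by
        refine ⟨h1, ?_⟩
        obtain ⟨N, hN⟩ := hf
        refine ⟨N, fun g hg => ?_⟩
        rw [mul_left_comm]
        exact Ideal.mul_mem_mul (Ideal.mem_span_singleton_self x) (hN g hg)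
      have h3 := hc n hn _ h2 (1 + e) (by omega) (hxh.mul hfe)
      obtain ⟨z, hz, hz'⟩ := Ideal.mem_span_singleton_mul.1 h3
      have := mul_left_cancel₀ (X_ne_zero (R := k) (⟨0, hd⟩ : Fin d)) hz'
      exact this ▸ hz
  intro f hf e he hfe
  obtain ⟨N, hN⟩ := hf
  exact key N f ⟨N, hN⟩ e he hfe (hN _ (Ideal.pow_mem_pow hxm N))
end Part2
section Part3
variable {k : Type} [Field k] {d : ℕ}

/-- exponents of leading monomials -/
def inSet (J : Ideal (MvPolynomial (Fin d) k)) : Set (Fin d → ℕ) :=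
  {a | ∃ f ∈ J, f ≠ 0 ∧ ⇑(MonomialOrder.degLex.degree f) = a}

noncomputable def trunc (J : Ideal (MvPolynomial (Fin d) k)) (N : ℕ) : Submodule k (MvPolynomial (Fin d) k) :=
  (J.restrictScalars k) ⊓ restrictTotalDegree (Fin d) k N

lemma mem_trunc {J : Ideal (MvPolynomial (Fin d) k)} {N : ℕ} {f : MvPolynomial (Fin d) k} :
    f ∈ trunc J N ↔ f ∈ J ∧ f.totalDegree ≤ N := by
  rw [trunc, Submodule.mem_inf, mem_restrictTotalDegree, Submodule.restrictScalars_mem]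

instance (J : Ideal (MvPolynomial (Fin d) k)) (N : ℕ) : Module.Finite k (trunc J N) :=
  Submodule.finiteDimensional_inf_right _ _

lemma lin_indep_of_degree_inj {ι : Type*} (f : ι → MvPolynomial (Fin d) k) (h0 : ∀ i, f i ≠ 0)
    (hinj : Function.Injective fun i => MonomialOrder.degLex.degree (f i)) :
    LinearIndependent k f := by
  classical
  rw [linearIndependent_iff']
  intro s g hg
  by_contra! hcon
  obtain ⟨i0, hi0, hgi0⟩ := hcon
  obtain ⟨i, hi, hmax⟩ := Finset.exists_max_image (s.filter fun i => g i ≠ 0)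
    (fun i => MonomialOrder.degLex.toSyn (MonomialOrder.degLex.degree (f i)))
    ⟨i0, by simp [hi0, hgi0]⟩
  rw [Finset.mem_filter] at hi
  have h1 := congrArg (coeff (MonomialOrder.degLex.degree (f i))) hg
  rw [coeff_sum, Finset.sum_eq_single i, coeff_smul, coeff_zero, smul_eq_mul, mul_eq_zero] at h1
  · rcases h1 with h1 | h1
    · exact hi.2 h1
    · exact (MonomialOrder.degLex.leadingCoeff_ne_zero_iff.2 (h0 i)) h1
  · intro j hj hji
    rw [coeff_smul]
    by_cases hgj : g j = 0
    · simp [hgj]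
    · rw [MonomialOrder.coeff_eq_zero_of_lt, smul_zero]
      refine lt_of_le_of_ne (hmax j (by simp [hj, hgj])) ?_
      intro h
      exact hji (hinj (MonomialOrder.degLex.toSyn.injective h))
  · intro h; exact absurd hi.1 h

lemma finrank_trunc (J : Ideal (MvPolynomial (Fin d) k)) (N : ℕ) :
    Module.finrank k (trunc J N) = Set.ncard {a | a ∈ inSet J ∧ ∑ i, a i ≤ N} := by
  classical
  set E := {a | a ∈ inSet J ∧ ∑ i, a i ≤ N} with hE
  have hfin : E.Finite := finite_count _ _
  have := hfin.fintype
  have hdeg : ∀ f : MvPolynomial (Fin d) k,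
      ∑ i, (MonomialOrder.degLex.degree f) i = f.totalDegree := by
    intro f
    rw [← degree_degLexDegree, Finsupp.degree_eq_sum]
  rw [← Nat.card_coe_set_eq, Nat.card_eq_fintype_card]
  apply le_antisymm
  · let φ : trunc J N →ₗ[k] (E → k) :=
      { toFun := fun f a => coeff (Finsupp.equivFunOnFinite.symm a.1) f.1
        map_add' := fun f g => by ext a; simp
        map_smul' := fun c f => by ext a; simp }
    have hφ : Function.Injective φ := by
      rw [injective_iff_map_eq_zero]
      intro f hf
      by_contra hne
      have hne' : f.1 ≠ 0 := fun h => hne (Subtype.ext h)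
      obtain ⟨h1, h2⟩ := mem_trunc.1 f.2
      have := congrFun hf ⟨⇑(MonomialOrder.degLex.degree f.1), ⟨f.1, h1, hne', rfl⟩,
        (hdeg f.1).trans_le h2⟩
      refine (MonomialOrder.degLex.leadingCoeff_ne_zero_iff.2 hne') ?_
      simpa [φ, MonomialOrder.leadingCoeff] using this
    simpa using LinearMap.finrank_le_finrank_of_injective hφ
  · have hch : ∀ a : E, ∃ f ∈ J, f ≠ 0 ∧ ⇑(MonomialOrder.degLex.degree f) = a.1 := fun a => a.2.1
    choose f hfJ hf0 hfa using hch
    have hmem : ∀ a, f a ∈ trunc J N := fun a => mem_trunc.2 ⟨hfJ a, by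
      rw [← hdeg, hfa]; exact a.2.2⟩
    have hli : LinearIndependent k f := lin_indep_of_degree_inj f hf0 (by
      intro a b hab
      apply Subtype.ext
      rw [← hfa, ← hfa]
      exact congrArg _ hab)
    have hli' : LinearIndependent k (fun a => (⟨f a, hmem a⟩ : trunc J N)) :=
      LinearIndependent.of_comp (trunc J N).subtype hli
    exact hli'.fintype_card_le_finrank

lemma mk_mem_H0 {R : Type*} [CommRing R] (J Q : Ideal R) (f : R) :
    (Ideal.Quotient.mk Q f) ∈ H0 (M := R ⧸ Q) J ↔ f ∈ sat J Q := by
  unfold H0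
  rw [Submodule.mem_iSup_of_directed, mem_sat]
  · refine exists_congr fun N => ?_
    rw [Submodule.mem_torsionBySet_iff]
    constructor
    · intro h g hg
      have := h ⟨g, hg⟩
      rw [← Ideal.Quotient.eq_zero_iff_mem]
      rw [map_mul]
      exact this
    · rintro h ⟨g, hg⟩
      have := h g hg
      rw [← Ideal.Quotient.eq_zero_iff_mem, map_mul] at this
      exact this
  · apply Monotone.directed_le
    intro a b hab
    exact Submodule.torsionBySet_le_torsionBySet_of_subset (Ideal.pow_le_pow_right hab)

lemma finrank_H0 (Q J : Ideal (MvPolynomial (Fin d) k)) (hJ : J = sat (idealOfVars (Fin d) k) Q)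
    (hQ : HC Q) (N : ℕ) (hN : ∀ f ∈ J, ∀ e ≥ N, f.IsHomogeneous e → f ∈ Q) :
    Module.finrank k (H0 (M := MvPolynomial (Fin d) k ⧸ Q) (idealOfVars (Fin d) k)) +
      Module.finrank k (trunc Q N) = Module.finrank k (trunc J N) := by
  have hJH : HC J := hJ ▸ hQ.sat
  have hQJ : Q ≤ J := hJ ▸ le_sat _ _
  let φ : trunc J N →ₗ[k] (MvPolynomial (Fin d) k ⧸ Q) :=
    (Ideal.Quotient.mkₐ k Q).toLinearMap ∘ₗ (trunc J N).subtype
  have hφ : ∀ f, φ f = Ideal.Quotient.mk Q f.1 := fun f => rfl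
  rw [← LinearMap.finrank_range_add_finrank_ker φ]
  congr 1
  · have : LinearMap.range φ = (H0 (M := MvPolynomial (Fin d) k ⧸ Q)
        (idealOfVars (Fin d) k)).restrictScalars k := by
      ext y
      rw [LinearMap.mem_range, Submodule.restrictScalars_mem]
      constructor
      · rintro ⟨f, rfl⟩
        rw [hφ, mk_mem_H0, ← hJ]
        exact (mem_trunc.1 f.2).1
      · intro hy
        obtain ⟨f, rfl⟩ := Ideal.Quotient.mk_surjective y
        rw [mk_mem_H0, ← hJ] at hy
        refine ⟨⟨∑ i ∈ Finset.range (N + 1), homogeneousComponent i f, mem_trunc.2 ⟨?_, ?_⟩⟩, ?_⟩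
        · exact Submodule.sum_mem _ fun i _ => hJH f hy i
        · refine totalDegree_finsetSum_le fun i hi => ?_
          have := (homogeneousComponent_isHomogeneous i f).totalDegree_le
          rw [Finset.mem_range] at hi
          omega
        · rw [hφ, Ideal.Quotient.eq]
          have h1 : f = ∑ i ∈ Finset.range (N + 1 + f.totalDegree), homogeneousComponent i f := by
            conv_lhs => rw [← sum_homogeneousComponent f]
            apply Finset.sum_subset
            · intro i; simp only [Finset.mem_range]; omega
            · intro i _ hi
              simp only [Finset.mem_range] at hi
              exact homogeneousComponent_eq_zero _ _ (by omega)
          rw [← neg_mem_iff, neg_sub]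
          conv in (f - _) => lhs; rw [h1]
          rw [← Finset.sum_sdiff_eq_sub (by intro i; simp only [Finset.mem_range]; omega)]
          refine Submodule.sum_mem _ fun i hi => ?_
          simp only [Finset.mem_sdiff, Finset.mem_range] at hi
          exact hN _ (hJH f hy i) i (by omega) (homogeneousComponent_isHomogeneous i f)
    rw [this]; rfl
  · symm
    refine LinearEquiv.finrank_eq ?_
    refine LinearEquiv.ofBijective
      (((trunc J N).subtype ∘ₗ (LinearMap.ker φ).subtype).codRestrict (trunc Q N) ?_) ⟨?_, ?_⟩
    · rintro ⟨f, hf⟩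
      rw [LinearMap.mem_ker, hφ, Ideal.Quotient.eq_zero_iff_mem] at hf
      exact mem_trunc.2 ⟨hf, (mem_trunc.1 f.2).2⟩
    · intro a b hab
      apply Subtype.ext; apply Subtype.ext
      exact congrArg (fun z : trunc Q N => z.1) hab
    · rintro ⟨f, hf⟩
      have h := mem_trunc.1 hf
      refine ⟨⟨⟨f, mem_trunc.2 ⟨hQJ h.1, h.2⟩⟩, ?_⟩, rfl⟩
      rw [LinearMap.mem_ker, hφ, Ideal.Quotient.eq_zero_iff_mem]
      exact h.1

lemma inSet_upper (J : Ideal (MvPolynomial (Fin d) k)) : IsUpperSet (inSet J) := by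
  rintro a b hab ⟨f, hf, hf0, rfl⟩
  obtain ⟨c, rfl⟩ : ∃ c, b = ⇑(MonomialOrder.degLex.degree f) + c :=
    ⟨b - ⇑(MonomialOrder.degLex.degree f), (add_tsub_cancel_of_le hab).symm⟩
  have hm : monomial (Finsupp.equivFunOnFinite.symm c) (1 : k) ≠ 0 := by simp
  refine ⟨f * monomial (Finsupp.equivFunOnFinite.symm c) 1, J.mul_mem_right _ hf,
    mul_ne_zero hf0 hm, ?_⟩
  classical
  rw [MonomialOrder.degree_mul hf0 hm, MonomialOrder.degree_monomial]
  simp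

lemma inSet_add {J K L : Ideal (MvPolynomial (Fin d) k)} (h : J * K ≤ L) {a b : Fin d → ℕ}
    (ha : a ∈ inSet J) (hb : b ∈ inSet K) : a + b ∈ inSet L := by
  obtain ⟨f, hf, hf0, rfl⟩ := ha
  obtain ⟨g, hg, hg0, rfl⟩ := hb
  refine ⟨f * g, h (Ideal.mul_mem_mul hf hg), mul_ne_zero hf0 hg0, ?_⟩
  rw [MonomialOrder.degree_mul hf0 hg0]
  simp

lemma inSet_nonempty {J : Ideal (MvPolynomial (Fin d) k)} (h : J ≠ ⊥) : (inSet J).Nonempty := by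
  obtain ⟨f, hf, hf0⟩ := Submodule.exists_mem_ne_zero_of_ne_bot h
  exact ⟨_, f, hf, hf0, rfl⟩

lemma sat_mul_sat {R : Type*} [CommRing R] (J A B : Ideal R) :
    sat J A * sat J B ≤ sat J (A * B) := by
  rw [Ideal.mul_le]
  rintro f ⟨N, hN⟩ g ⟨M, hM⟩
  refine ⟨N + M, fun r hr => ?_⟩
  rw [pow_add] at hr
  have : J ^ N * J ^ M ≤ Submodule.comap (LinearMap.mulRight R (f * g)) (A * B) := by
    rw [Ideal.mul_le]
    intro a ha b hb
    have := Ideal.mul_mem_mul (hN a ha) (hM b hb)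
    rw [mul_mul_mul_comm] at this
    exact this
  exact this hr

theorem H0_limit (hd : 0 < d) {I : Ideal (MvPolynomial (Fin d) k)} (hI : HC I) :
    ∃ L : ℝ, Tendsto (fun n : ℕ => (Module.finrank k (H0 (M := MvPolynomial (Fin d) k ⧸ I ^ n)
      (idealOfVars (Fin d) k)) : ℝ) / (n : ℝ) ^ d) atTop (nhds L) := by
  obtain ⟨c, hc⟩ := degree_bound hd hI
  have key : ∀ n ≥ 1, Module.finrank k (H0 (M := MvPolynomial (Fin d) k ⧸ I ^ n)
      (idealOfVars (Fin d) k)) + Module.finrank k (trunc (I ^ n) (c * n)) =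
      Module.finrank k (trunc (sat (idealOfVars (Fin d) k) (I ^ n)) (c * n)) := fun n hn =>
    finrank_H0 (I ^ n) _ rfl (hI.pow n) (c * n) (hc n hn)
  by_cases hI0 : I = ⊥
  · refine ⟨0, ?_⟩
    apply tendsto_const_nhds.congr'
    filter_upwards [eventually_ge_atTop 1] with n hn
    have h := key n hn
    have h1 : I ^ n = ⊥ := by
      rw [hI0, ← Ideal.zero_eq_bot, zero_pow (by omega)]
    have h2 : sat (idealOfVars (Fin d) k) (I ^ n) = I ^ n := by
      apply le_antisymm _ (le_sat _ _)
      rw [h1]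
      rintro f ⟨N, hN⟩
      have := hN (X ⟨0, hd⟩ ^ N) (Ideal.pow_mem_pow (Ideal.subset_span (Set.mem_range_self _)) N)
      rw [Ideal.mem_bot] at this ⊢
      exact (mul_eq_zero.1 this).resolve_left (pow_ne_zero _ (X_ne_zero _))
    rw [h2] at h
    have h3 : Module.finrank k (H0 (M := MvPolynomial (Fin d) k ⧸ I ^ n)
      (idealOfVars (Fin d) k)) = 0 := by omega
    rw [h3]; simp
  · have hn0 : ∀ n, I ^ n ≠ ⊥ := fun n => pow_ne_zero n hI0
    obtain ⟨L1, hL1⟩ := count_limit hd (fun n => inSet (I ^ n)) (fun n => inSet_upper _)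
      (fun n m a b ha hb => inSet_add (by rw [pow_add]) ha hb)
      (fun n => inSet_nonempty (hn0 n)) c
    obtain ⟨L2, hL2⟩ := count_limit hd
      (fun n => inSet (sat (idealOfVars (Fin d) k) (I ^ n))) (fun n => inSet_upper _)
      (fun n m a b ha hb => inSet_add (by rw [pow_add]; exact sat_mul_sat _ _ _) ha hb)
      (fun n => inSet_nonempty (fun h => hn0 n (le_bot_iff.1 (h ▸ le_sat _ _)))) c
    refine ⟨L2 - L1, (hL2.sub hL1).congr' ?_⟩
    filter_upwards [eventually_ge_atTop 1] with n hn
    have h := key n hn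
    rw [finrank_trunc, finrank_trunc] at h
    rw [← h]
    push_cast
    ring
end Part3
section Part4
open CategoryTheory CategoryTheory.Abelian

section generic
variable {R : Type} [CommRing R]

/-- Ext groups into `R`. -/
noncomputable abbrev EX (R : Type) [CommRing R] (M : Type) [AddCommGroup M] [Module R M] (i : ℕ) :
    Type :=
  Abelian.Ext (ModuleCat.of R M) (ModuleCat.of R R) i

variable {M M₁ M₂ M₃ : Type} [AddCommGroup M] [Module R M] [AddCommGroup M₁] [Module R M₁]
  [AddCommGroup M₂] [Module R M₂] [AddCommGroup M₃] [Module R M₃]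

noncomputable def pre (f : M₁ →ₗ[R] M₂) (i : ℕ) : EX R M₂ i →ₗ[R] EX R M₁ i :=
  (Ext.mk₀ (ModuleCat.ofHom f)).precompOfLinear R _ (zero_add i)

lemma pre_apply (f : M₁ →ₗ[R] M₂) (i : ℕ) (e : EX R M₂ i) :
    pre f i e = (Ext.mk₀ (ModuleCat.ofHom f)).comp e (zero_add i) := rfl

lemma pre_smul_id (r : R) (i : ℕ) (e : EX R M i) :
    pre (r • (LinearMap.id : M →ₗ[R] M)) i e = r • e := by
  rw [pre_apply]
  have : ModuleCat.ofHom (r • (LinearMap.id : M →ₗ[R] M)) = r • 𝟙 (ModuleCat.of R M) := rfl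
  rw [this, Ext.mk₀_smul, Ext.smul_comp, Ext.mk₀_id_comp]

lemma les (f : M₁ →ₗ[R] M₂) (g : M₂ →ₗ[R] M₃) (hf : Function.Injective f)
    (hg : Function.Surjective g) (hfg : Function.Exact f g) :
    (∀ i, Function.Exact (pre g i) (pre f i)) ∧ Function.Injective (pre g 0) ∧
    ∃ δ : ∀ i, EX R M₁ i →ₗ[R] EX R M₃ (i + 1),
      (∀ i, Function.Exact (pre f i) (δ i)) ∧ (∀ i, Function.Exact (δ i) (pre g (i + 1))) := by
  let S : ShortComplex (ModuleCat R) := ShortComplex.mk (ModuleCat.ofHom f) (ModuleCat.ofHom g)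
    (by
      rw [← ModuleCat.ofHom_comp, hfg.linearMap_comp_eq_zero]; rfl)
  have hmono : Mono S.f := (ModuleCat.mono_iff_injective _).2 hf
  have hepi : Epi S.g := (ModuleCat.epi_iff_surjective _).2 hg
  have hS : S.ShortExact :=
    { exact := (ShortComplex.ShortExact.moduleCat_exact_iff_function_exact S).2 hfg }
  refine ⟨fun i => ?_, ?_, fun i => hS.extClass.precompOfLinear R _ (add_comm 1 i), ?_, ?_⟩
  · exact (ShortComplex.ab_exact_iff_function_exact _).1
        (Ext.contravariant_sequence_exact₂' hS (ModuleCat.of R R) i)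
  · exact Ext.precomp_mk₀_injective_of_epi (ModuleCat.of R R) S.g
  · intro i
    exact (ShortComplex.ab_exact_iff_function_exact _).1
        (Ext.contravariant_sequence_exact₁' hS (ModuleCat.of R R) i (i + 1) (add_comm 1 i))
  · intro i
    exact (ShortComplex.ab_exact_iff_function_exact _).1
        (Ext.contravariant_sequence_exact₃' hS (ModuleCat.of R R) i (i + 1) (add_comm 1 i))

/-- multiplication by `f` from `R/P` to `R/J`. -/
noncomputable def mulQ (P J : Ideal R) (f : R) (h : ∀ r, r * f ∈ J ↔ r ∈ P) :
    (R ⧸ P) →ₗ[R] (R ⧸ J) :=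
  Submodule.mapQ P J (LinearMap.mulRight R f) (fun r hr => (h r).2 hr)

lemma mulQ_mk (P J : Ideal R) (f : R) (h : ∀ r, r * f ∈ J ↔ r ∈ P) (r : R) :
    mulQ P J f h (Ideal.Quotient.mk P r) = Ideal.Quotient.mk J (r * f) := rfl

lemma mulQ_inj (P J : Ideal R) (f : R) (h : ∀ r, r * f ∈ J ↔ r ∈ P) :
    Function.Injective (mulQ P J f h) := by
  rw [injective_iff_map_eq_zero]
  intro y hy
  obtain ⟨r, rfl⟩ := Ideal.Quotient.mk_surjective y
  rw [mulQ_mk, Ideal.Quotient.eq_zero_iff_mem, h] at hy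
  exact Ideal.Quotient.eq_zero_iff_mem.2 hy

noncomputable def facQ (J : Ideal R) (f : R) : (R ⧸ J) →ₗ[R] (R ⧸ (J ⊔ Ideal.span {f})) :=
  Submodule.mapQ J (J ⊔ Ideal.span {f}) LinearMap.id (le_sup_left)

lemma facQ_mk (J : Ideal R) (f : R) (r : R) :
    facQ J f (Ideal.Quotient.mk J r) = Ideal.Quotient.mk _ r := rfl

lemma facQ_surj (J : Ideal R) (f : R) : Function.Surjective (facQ J f) := by
  intro y
  obtain ⟨r, rfl⟩ := Ideal.Quotient.mk_surjective y
  exact ⟨_, facQ_mk J f r⟩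

lemma mem_sup_span {J : Ideal R} {f r : R} :
    r ∈ J ⊔ Ideal.span {f} ↔ ∃ s, r - s * f ∈ J := by
  rw [Submodule.mem_sup]
  constructor
  · rintro ⟨y, hy, z, hz, rfl⟩
    obtain ⟨s, rfl⟩ := Ideal.mem_span_singleton'.1 hz
    exact ⟨s, by simpa using hy⟩
  · rintro ⟨s, hs⟩
    exact ⟨_, hs, s * f, Ideal.mem_span_singleton'.2 ⟨s, rfl⟩, by ring⟩

lemma mulQ_exact (P J : Ideal R) (f : R) (h : ∀ r, r * f ∈ J ↔ r ∈ P) :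
    Function.Exact (mulQ P J f h) (facQ J f) := by
  intro y
  obtain ⟨r, rfl⟩ := Ideal.Quotient.mk_surjective y
  rw [facQ_mk, Ideal.Quotient.eq_zero_iff_mem, mem_sup_span]
  constructor
  · rintro ⟨s, hs⟩
    exact ⟨Ideal.Quotient.mk _ s, by rw [mulQ_mk, eq_comm, Ideal.Quotient.eq]; exact hs⟩
  · rintro ⟨z, hz⟩
    obtain ⟨s, rfl⟩ := Ideal.Quotient.mk_surjective z
    rw [mulQ_mk, eq_comm, Ideal.Quotient.eq] at hz
    exact ⟨s, hz⟩

lemma mulQ_self (J : Ideal R) (f : R) (h : ∀ r, r * f ∈ J ↔ r ∈ J) :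
    mulQ J J f h = f • LinearMap.id := by
  ext
  change Ideal.Quotient.mk J (1 * f) = f • Ideal.Quotient.mk J 1
  rw [one_mul]
  change Ideal.Quotient.mk J f = Ideal.Quotient.mk J (f * 1)
  rw [mul_one]

/-- The Ext groups of `R/Q` into `R` behave like those of a complete intersection. -/
def KC (Q : Ideal R) (j : ℕ) : Prop :=
  (∀ i, i ≠ j → Subsingleton (EX R (R ⧸ Q) i)) ∧ Nonempty (EX R (R ⧸ Q) j ≃ₗ[R] (R ⧸ Q))

lemma koszul_step {Q : Ideal R} {j : ℕ} (hK : KC Q j) (x : R) (hx : ∀ r, r * x ∈ Q ↔ r ∈ Q) :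
    KC (Q ⊔ Ideal.span {x}) (j + 1) := by
  obtain ⟨hK1, ⟨θ⟩⟩ := hK
  obtain ⟨h2, h0, δ, h1, h3⟩ := les (mulQ Q Q x hx) (facQ Q x) (mulQ_inj _ _ _ _) (facQ_surj _ _)
    (mulQ_exact _ _ _ _)
  have hmul : ∀ i (e : EX R (R ⧸ Q) i), pre (mulQ Q Q x hx) i e = x • e := by
    intro i e
    rw [mulQ_self, pre_smul_id]
  have hinj : ∀ i (e : EX R (R ⧸ Q) i), x • e = 0 → e = 0 := by
    intro i e he
    by_cases hi : i = j
    · subst hi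
      have h4 : x • θ e = 0 := by rw [← map_smul, he, map_zero]
      obtain ⟨r, hr⟩ := Ideal.Quotient.mk_surjective (θ e)
      rw [← hr] at h4
      have h5 : Ideal.Quotient.mk Q (x * r) = 0 := h4
      rw [Ideal.Quotient.eq_zero_iff_mem, mul_comm, hx] at h5
      have h6 : θ e = 0 := by rw [← hr]; exact Ideal.Quotient.eq_zero_iff_mem.2 h5
      exact θ.map_eq_zero_iff.1 h6
    · have := hK1 i hi
      exact Subsingleton.elim _ _
  have hpre : ∀ i e, pre (facQ Q x) i e = 0 := by
    intro i e
    apply hinj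
    rw [← hmul]
    exact (h2 i).apply_apply_eq_zero e
  refine ⟨?_, ?_⟩
  · intro i hi
    refine subsingleton_of_forall_eq 0 fun e => ?_
    rcases i with _ | i
    · exact h0 (by rw [hpre, hpre])
    · obtain ⟨e1, rfl⟩ := (h3 i e).1 (hpre _ _)
      have := hK1 i (by omega)
      rw [Subsingleton.elim e1 0, map_zero]
  · let ψ : R →ₗ[R] EX R (R ⧸ (Q ⊔ Ideal.span {x})) (j + 1) :=
      δ j ∘ₗ θ.symm.toLinearMap ∘ₗ (Submodule.mkQ Q)
    have hψs : Function.Surjective ψ := by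
      intro e
      obtain ⟨e1, rfl⟩ := (h3 j e).1 (hpre _ _)
      obtain ⟨r, hr⟩ := Ideal.Quotient.mk_surjective (θ e1)
      refine ⟨r, ?_⟩
      change δ j (θ.symm (Ideal.Quotient.mk Q r)) = _
      rw [hr, LinearEquiv.symm_apply_apply]
    have hker : LinearMap.ker ψ = Q ⊔ Ideal.span {x} := by
      ext r
      rw [LinearMap.mem_ker, mem_sup_span]
      change δ j (θ.symm (Ideal.Quotient.mk Q r)) = 0 ↔ _
      rw [h1 j]
      constructor
      · rintro ⟨e, he⟩
        rw [hmul] at he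
        obtain ⟨s, hs⟩ := Ideal.Quotient.mk_surjective (θ e)
        have : x • θ e = Ideal.Quotient.mk Q r := by
          rw [← map_smul, he, LinearEquiv.apply_symm_apply]
        rw [← hs] at this
        have h5 : Ideal.Quotient.mk Q (x * s) = Ideal.Quotient.mk Q r := this
        rw [eq_comm, Ideal.Quotient.eq, mul_comm] at h5
        exact ⟨s, h5⟩
      · rintro ⟨s, hs⟩
        refine ⟨θ.symm (Ideal.Quotient.mk Q s), ?_⟩
        rw [hmul, ← map_smul]
        congr 1
        change Ideal.Quotient.mk Q (x * s) = Ideal.Quotient.mk Q r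
        rw [eq_comm, Ideal.Quotient.eq, mul_comm]
        exact hs
    exact ⟨((Submodule.quotEquivOfEq _ _ hker).symm.trans
      (ψ.quotKerEquivOfSurjective hψs)).symm⟩

lemma koszul_base : KC (⊥ : Ideal R) 0 := by
  let e : (R ⧸ (⊥ : Ideal R)) ≃ₗ[R] R := Submodule.quotEquivOfEqBot _ rfl
  have : Module.Projective R (R ⧸ (⊥ : Ideal R)) := Module.Projective.of_equiv e.symm
  have : Projective (ModuleCat.of R (R ⧸ (⊥ : Ideal R))) := inferInstance
  refine ⟨fun i hi => ?_, ⟨?_⟩⟩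
  · obtain ⟨i, rfl⟩ := Nat.exists_eq_succ_of_ne_zero hi
    exact subsingleton_of_forall_eq 0 fun e => Ext.eq_zero_of_projective e
  · let e1 : EX R (R ⧸ (⊥ : Ideal R)) 0 ≃ₗ[R]
      (ModuleCat.of R (R ⧸ (⊥ : Ideal R)) ⟶ ModuleCat.of R R) := Ext.linearEquiv₀ (R := R)
    let e2 : (ModuleCat.of R (R ⧸ (⊥ : Ideal R)) ⟶ ModuleCat.of R R) ≃ₗ[R]
      ((R ⧸ (⊥ : Ideal R)) →ₗ[R] R) := ModuleCat.homLinearEquiv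
    let e3 : ((R ⧸ (⊥ : Ideal R)) →ₗ[R] R) ≃ₗ[R] (R →ₗ[R] R) :=
      e.arrowCongr (LinearEquiv.refl R R)
    let e4 : (R →ₗ[R] R) ≃ₗ[R] R := LinearMap.ringLmapEquivSelf R R R
    exact e1.trans (e2.trans (e3.trans (e4.trans e.symm)))

lemma EX_subsingleton_of_subsingleton [Subsingleton M] (i : ℕ) : Subsingleton (EX R M i) := by
  refine subsingleton_of_forall_eq 0 fun e => ?_
  rw [← one_smul R e, ← pre_smul_id]
  have : ((1 : R) • (LinearMap.id : M →ₗ[R] M)) = (0 : R) • LinearMap.id := by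
    ext; exact Subsingleton.elim _ _
  rw [this, pre_smul_id, zero_smul]
end generic
end Part4
section Part5
open CategoryTheory CategoryTheory.Abelian
section annst
variable {R : Type} [CommRing R]

/-- `σ` as a linear iso from `R/J` to the restriction of `R/J` along `σ`. -/
noncomputable def twist (σ : R ≃+* R) (J : Ideal R) (hJ : ∀ r, σ r ∈ J ↔ r ∈ J) :
    ModuleCat.of R (R ⧸ J) ≅
      (ModuleCat.restrictScalars (σ : R ≃+* R).toRingHom).obj (ModuleCat.of R (R ⧸ J)) := by
  have h1 : J = Ideal.map (σ : R →+* R) J := by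
    apply le_antisymm
    · intro r hr
      have : r = σ (σ.symm r) := by simp
      rw [this]
      exact Ideal.mem_map_of_mem _ ((hJ _).1 (this ▸ hr))
    · rw [Ideal.map_le_iff_le_comap]
      intro r hr
      exact (hJ r).2 hr
  let q : (R ⧸ J) ≃+* (R ⧸ J) := Ideal.quotientEquiv J J σ h1
  let M2 := (ModuleCat.restrictScalars (σ : R ≃+* R).toRingHom).obj (ModuleCat.of R (R ⧸ J))
  let q' : (R ⧸ J) ≃+ M2 := q.toAddEquiv
  refine LinearEquiv.toModuleIso (q'.toLinearEquiv ?_ : (R ⧸ J) ≃ₗ[R] M2)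
  intro r y
  obtain ⟨s, rfl⟩ := Ideal.Quotient.mk_surjective y
  change q (Ideal.Quotient.mk J (r * s)) = Ideal.Quotient.mk J (σ r) * q (Ideal.Quotient.mk J s)
  rw [map_mul, map_mul]
  rfl

noncomputable def twistR (σ : R ≃+* R) :
    ModuleCat.of R R ≅
      (ModuleCat.restrictScalars (σ : R ≃+* R).toRingHom).obj (ModuleCat.of R R) := by
  let M2 := (ModuleCat.restrictScalars (σ : R ≃+* R).toRingHom).obj (ModuleCat.of R R)
  let q' : R ≃+ M2 := σ.toAddEquiv
  refine LinearEquiv.toModuleIso (q'.toLinearEquiv ?_ : R ≃ₗ[R] M2)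
  intro r y
  exact σ.map_mul r y

lemma restrict_projective (σ : R ≃+* R) :
    (ModuleCat.restrictScalars.{0} (σ : R ≃+* R).toRingHom).PreservesProjectiveObjects where
  projective_obj := by
    intro X hX
    exact ((ModuleCat.restrictScalarsEquivalenceOfRingEquiv σ).map_projective_iff X).2 hX

lemma ann_stable (σ : R ≃+* R) (J : Ideal R) (hJ : ∀ r, σ r ∈ J ↔ r ∈ J) (i : ℕ) (r : R)
    (hr : ∀ e : EX R (R ⧸ J) i, r • e = 0) (e : EX R (R ⧸ J) i) : σ r • e = 0 := by
  have := restrict_projective σ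
  let F := ModuleCat.restrictScalars.{0} (σ : R ≃+* R).toRingHom
  let α := twist σ J hJ
  let β := twistR σ
  have hF : F.map (σ r • 𝟙 (ModuleCat.of R R)) = r • 𝟙 (F.obj (ModuleCat.of R R)) := by
    ext y
    rfl
  have h1 : r • e.mapExactFunctor F = 0 := by
    have h2 := hr (((Ext.mk₀ α.hom).comp (e.mapExactFunctor F) (zero_add i)).comp
      (Ext.mk₀ β.inv) (add_zero i))
    have h3 := congrArg (fun z => ((Ext.mk₀ α.inv).comp z (zero_add i)).comp
      (Ext.mk₀ β.hom) (add_zero i)) h2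
    simp only [Ext.smul_comp, Ext.comp_smul, Ext.comp_zero, Ext.zero_comp,
      Ext.comp_assoc_of_third_deg_zero, Ext.mk₀_comp_mk₀, Ext.mk₀_comp_mk₀_assoc,
      Iso.inv_hom_id, Ext.comp_mk₀_id, Ext.mk₀_id_comp] at h3
    exact h3
  apply (Functor.mapExt_bijective_of_preservesProjectiveObjects F
    (ModuleCat.of R (R ⧸ J)) (ModuleCat.of R R) i).1
  rw [map_zero, Functor.mapExtAddHom_apply, Ext.smul_eq_comp_mk₀, Ext.mapExactFunctor_comp,
    Ext.mapExactFunctor_mk₀, hF, ← Ext.smul_eq_comp_mk₀]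
  exact h1
end annst
end Part5
section Part6
open CategoryTheory CategoryTheory.Abelian
variable {k : Type} [Field k] {d : ℕ}

/-- the `k`-dimension (a cardinal) of a module over the polynomial ring -/
noncomputable def kr (k : Type) [Field k] (d : ℕ) (E : Type) [AddCommGroup E]
    [Module (MvPolynomial (Fin d) k) E] : Cardinal :=
  letI := Module.compHom E (algebraMap k (MvPolynomial (Fin d) k))
  Module.rank k E

lemma kr_exact {E₁ E₂ E₃ : Type} [AddCommGroup E₁] [Module (MvPolynomial (Fin d) k) E₁]
    [AddCommGroup E₂] [Module (MvPolynomial (Fin d) k) E₂]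
    [AddCommGroup E₃] [Module (MvPolynomial (Fin d) k) E₃]
    (f : E₁ →ₗ[MvPolynomial (Fin d) k] E₂) (g : E₂ →ₗ[MvPolynomial (Fin d) k] E₃)
    (hf : Function.Injective f) (hg : Function.Surjective g) (h : Function.Exact f g) :
    kr k d E₂ = kr k d E₃ + kr k d E₁ := by
  let _ := Module.compHom E₁ (algebraMap k (MvPolynomial (Fin d) k))
  let _ := Module.compHom E₂ (algebraMap k (MvPolynomial (Fin d) k))
  let _ := Module.compHom E₃ (algebraMap k (MvPolynomial (Fin d) k))
  let f' : E₁ →ₗ[k] E₂ :=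
    { toFun := f, map_add' := f.map_add, map_smul' := fun c x => f.map_smul (algebraMap k _ c) x }
  let g' : E₂ →ₗ[k] E₃ :=
    { toFun := g, map_add' := g.map_add, map_smul' := fun c x => g.map_smul (algebraMap k _ c) x }
  have h1 := LinearMap.rank_eq_of_surjective (f := g') hg
  have h2 : LinearMap.ker g' = LinearMap.range f' := by
    ext x; exact h x
  have h3 := rank_range_of_injective f' hf
  rw [h2, h3] at h1
  exact h1

lemma kr_congr {E₁ E₂ : Type} [AddCommGroup E₁] [Module (MvPolynomial (Fin d) k) E₁]
    [AddCommGroup E₂] [Module (MvPolynomial (Fin d) k) E₂]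
    (f : E₁ ≃ₗ[MvPolynomial (Fin d) k] E₂) : kr k d E₁ = kr k d E₂ := by
  let _ := Module.compHom E₁ (algebraMap k (MvPolynomial (Fin d) k))
  let _ := Module.compHom E₂ (algebraMap k (MvPolynomial (Fin d) k))
  let f' : E₁ ≃ₗ[k] E₂ :=
    { f.toEquiv with
      map_add' := f.map_add
      map_smul' := fun c x => f.map_smul (algebraMap k _ c) x }
  exact f'.rank_eq

lemma kr_subsingleton {E : Type} [AddCommGroup E] [Module (MvPolynomial (Fin d) k) E]
    [Subsingleton E] : kr k d E = 0 := by
  let _ := Module.compHom E (algebraMap k (MvPolynomial (Fin d) k))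
  exact rank_subsingleton' k E

lemma kc_vars_aux (j : ℕ) (hj : j ≤ d) :
    KC (Ideal.span ((X : Fin d → MvPolynomial (Fin d) k) '' {i | i.1 < j})) j := by
  induction j with
  | zero =>
    have : (Ideal.span ((X : Fin d → MvPolynomial (Fin d) k) '' {i | i.1 < 0})) = ⊥ := by simp
    rw [this]; exact koszul_base
  | succ j ih =>
    have h1 : (Ideal.span ((X : Fin d → MvPolynomial (Fin d) k) '' {i | i.1 < j + 1})) =
        Ideal.span ((X : Fin d → MvPolynomial (Fin d) k) '' {i | i.1 < j}) ⊔
          Ideal.span {X ⟨j, hj⟩} := by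
      rw [← Ideal.span_union, ← Set.image_singleton, ← Set.image_union]
      congr 2
      ext i
      simp only [Set.mem_ofPred_eq, Set.mem_union, Set.mem_singleton_iff, Fin.ext_iff]
      omega
    rw [h1]
    refine koszul_step (ih (by omega)) _ fun r => ⟨fun h => ?_, fun h => Ideal.mul_mem_right _ _ h⟩
    rw [mem_ideal_span_X_image] at h ⊢
    intro s hs
    obtain ⟨i, hi, hi'⟩ := h (s + Finsupp.single ⟨j, hj⟩ 1) (by
      rw [mem_support_iff, coeff_mul_X]
      exact mem_support_iff.1 hs)
    refine ⟨i, hi, ?_⟩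
    have : (⟨j, hj⟩ : Fin d) ≠ i := by
      rintro rfl
      simp at hi
    simpa [Finsupp.single_apply, this] using hi'

lemma kc_vars : KC (idealOfVars (Fin d) k) d := by
  have := kc_vars_aux (k := k) d le_rfl
  have h : {i : Fin d | i.1 < d} = Set.univ := by ext i; simp
  rw [h, Set.image_univ] at this
  exact this

/-- scaling of variables -/
noncomputable def scal (t : k) : MvPolynomial (Fin d) k →ₐ[k] MvPolynomial (Fin d) k :=
  aeval fun i => C t * X i

lemma scal_comp (s t : k) (hst : s * t = 1) (f : MvPolynomial (Fin d) k) :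
    scal s (scal t f) = f := by
  have : (scal s).comp (scal t) = AlgHom.id k (MvPolynomial (Fin d) k) := by
    ext1 i
    simp only [scal, AlgHom.comp_apply, aeval_X, map_mul, AlgHom.id_apply]
    rw [show (aeval fun i => C s * X i) (C t) = (C t : MvPolynomial (Fin d) k) from aeval_C _ _]
    rw [← mul_assoc, ← C_mul, mul_comm t s, hst]; simp
  exact DFunLike.congr_fun this f

noncomputable def scalEquiv (t : k) (ht : t ≠ 0) :
    MvPolynomial (Fin d) k ≃+* MvPolynomial (Fin d) k :=
  { (scal t : MvPolynomial (Fin d) k →ₐ[k] MvPolynomial (Fin d) k).toRingHom with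
    invFun := scal t⁻¹
    left_inv := fun f => scal_comp _ _ (inv_mul_cancel₀ ht) f
    right_inv := fun f => scal_comp _ _ (mul_inv_cancel₀ ht) f }

lemma scal_hom (t : k) {f : MvPolynomial (Fin d) k} {j : ℕ} (hf : f.IsHomogeneous j) :
    scal t f = C (t ^ j) * f := by
  conv_lhs => rw [f.as_sum]
  conv_rhs => rw [f.as_sum]
  rw [map_sum, Finset.mul_sum]
  refine Finset.sum_congr rfl fun s hs => ?_
  have hdeg : s.degree = j := hf.degree_eq_sum_deg_support hs ▸ rfl
  rw [scal, aeval_monomial, monomial_eq, algebraMap_eq]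
  simp only [mul_pow, Finsupp.prod_mul]
  have : (s.prod fun _ n => (C t : MvPolynomial (Fin d) k) ^ n) = C (t ^ j) := by
    rw [← hdeg, Finsupp.prod, Finset.prod_pow_eq_pow_sum, ← C_pow, Finsupp.degree]
    rfl
  rw [this]; ring

lemma scal_eq_sum (t : k) (f : MvPolynomial (Fin d) k) :
    scal t f = ∑ i ∈ Finset.range (f.totalDegree + 1), C (t ^ i) * homogeneousComponent i f := by
  conv_lhs => rw [← sum_homogeneousComponent f]
  rw [map_sum]
  exact Finset.sum_congr rfl fun i _ => scal_hom t (homogeneousComponent_isHomogeneous i f)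

lemma scal_mem {J : Ideal (MvPolynomial (Fin d) k)} (hJ : HC J) (t : k)
    {f : MvPolynomial (Fin d) k} (hf : f ∈ J) : scal t f ∈ J := by
  rw [scal_eq_sum]
  exact Submodule.sum_mem _ fun i _ => Ideal.mul_mem_left _ _ (hJ f hf i)

/-- an ideal stable under scaling contains the constant terms -/
lemma const_mem [Infinite k] {A : Ideal (MvPolynomial (Fin d) k)}
    (hA : ∀ t : k, t ≠ 0 → ∀ f ∈ A, scal t f ∈ A) {f : MvPolynomial (Fin d) k} (hf : f ∈ A) :
    homogeneousComponent 0 f ∈ A := by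
  rw [← Ideal.Quotient.eq_zero_iff_mem]
  rw [← Module.forall_dual_apply_eq_zero_iff k]
  intro l
  let p : Polynomial k := ∑ i ∈ Finset.range (f.totalDegree + 1),
    Polynomial.monomial i (l (Ideal.Quotient.mk A (homogeneousComponent i f)))
  have hp : Polynomial.X * p = 0 := by
    apply Polynomial.funext
    intro t
    by_cases ht : t = 0
    · simp [ht]
    rw [Polynomial.eval_mul, Polynomial.eval_zero]
    apply mul_eq_zero_of_right
    have h1 := hA t ht f hf
    rw [scal_eq_sum, ← Ideal.Quotient.eq_zero_iff_mem, map_sum] at h1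
    have h2 := congrArg l h1
    rw [map_sum, map_zero] at h2
    rw [Polynomial.eval_finsetSum, ← h2]
    refine Finset.sum_congr rfl fun i _ => ?_
    rw [Polynomial.eval_monomial]
    have h3 : Ideal.Quotient.mk A (C (t ^ i) * homogeneousComponent i f) =
        (t ^ i) • Ideal.Quotient.mk A (homogeneousComponent i f) := by
      rw [← smul_eq_C_mul]; rfl
    rw [h3, map_smul, smul_eq_mul, mul_comm]
  have hp0 : p = 0 := (mul_eq_zero.1 hp).resolve_left Polynomial.X_ne_zero
  have h4 := congrArg (fun q => Polynomial.coeff q 0) hp0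
  simp only [p, Polynomial.finsetSum_coeff, Polynomial.coeff_monomial, Polynomial.coeff_zero,
    Finset.sum_ite_eq', Finset.mem_range] at h4
  simpa using h4

lemma vanish [Infinite k] {J : Ideal (MvPolynomial (Fin d) k)} (hJ : HC J) (i : ℕ)
    (x : MvPolynomial (Fin d) k) (hx : x ∈ idealOfVars (Fin d) k)
    (hs : ∀ e : EX (MvPolynomial (Fin d) k) (MvPolynomial (Fin d) k ⧸ J) i, ∃ e', x • e' = e) :
    Subsingleton (EX (MvPolynomial (Fin d) k) (MvPolynomial (Fin d) k ⧸ J) i) := by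
  set E := EX (MvPolynomial (Fin d) k) (MvPolynomial (Fin d) k ⧸ J) i with hE
  have hfin : Module.Finite (MvPolynomial (Fin d) k) E := by
    exact ModuleCat.finite_ext _ (ModuleCat.of _ _) (ModuleCat.of _ _) i
  obtain ⟨r, hr1, hr2⟩ := Submodule.exists_sub_one_mem_and_smul_eq_zero_of_fg_of_le_smul
    (Ideal.span {x}) (⊤ : Submodule (MvPolynomial (Fin d) k) E) hfin.fg_top (by
      intro e _
      obtain ⟨e', rfl⟩ := hs e
      exact Submodule.smul_mem_smul (Ideal.mem_span_singleton_self x) trivial)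
  have hc : homogeneousComponent 0 r = 1 := by
    rw [homogeneousComponent_zero]
    have h1 : r - 1 ∈ idealOfVars (Fin d) k ^ 1 := by
      rw [pow_one]
      exact (Ideal.span_le.2 (by simpa using hx)) hr1
    rw [mem_pow_idealOfVars_iff'] at h1
    have h2 := h1 0 (by simp)
    rw [coeff_sub, coeff_zero_one, sub_eq_zero] at h2
    rw [h2, C_1]
  have h1 : (1 : MvPolynomial (Fin d) k) ∈ Module.annihilator (MvPolynomial (Fin d) k) E := by
    rw [← hc]
    apply const_mem
    · intro t ht f hf
      rw [Module.mem_annihilator] at hf ⊢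
      refine ann_stable (scalEquiv t ht) J (fun r => ⟨fun h => ?_, fun h => scal_mem hJ t h⟩) i f hf
      have := scal_mem hJ t⁻¹ h
      rwa [show (scalEquiv t ht) r = scal t r from rfl, scal_comp _ _ (inv_mul_cancel₀ ht)] at this
    · rw [Module.mem_annihilator]
      exact fun e => hr2 e trivial
  rw [Module.mem_annihilator] at h1
  exact subsingleton_of_forall_eq 0 fun e => by simpa using h1 e

lemma exists_linear_nzd [Infinite k] {J : Ideal (MvPolynomial (Fin d) k)}
    (hsat : sat (idealOfVars (Fin d) k) J = J) :
    ∃ x : MvPolynomial (Fin d) k, x.IsHomogeneous 1 ∧ ∀ r, r * x ∈ J ↔ r ∈ J := by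
  classical
  let M := MvPolynomial (Fin d) k ⧸ J
  have hfin := associatedPrimes.finite (MvPolynomial (Fin d) k) M
  let Λ : (Fin d → k) →ₗ[k] MvPolynomial (Fin d) k := Fintype.linearCombination k X
  have hΛ : ∀ v, (Λ v).IsHomogeneous 1 := by
    intro v
    rw [Fintype.linearCombination_apply]
    refine IsHomogeneous.sum _ _ _ fun i _ => ?_
    rw [smul_eq_C_mul]
    exact isHomogeneous_C_mul_X _ _
  let s : Finset (Subspace k (Fin d → k)) := hfin.toFinset.image fun P =>
    (P.restrictScalars k).comap Λ
  have hs : ⊤ ∉ s := by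
    intro h
    obtain ⟨P, hP, hPt⟩ := Finset.mem_image.1 h
    rw [Set.Finite.mem_toFinset] at hP
    obtain ⟨hPp, y, hy⟩ := (isAssociatedPrime_iff.1 hP)
    obtain ⟨f, rfl⟩ := Ideal.Quotient.mk_surjective y
    have hmP : idealOfVars (Fin d) k ≤ P := by
      rw [idealOfVars, Ideal.span_le]
      rintro _ ⟨i, rfl⟩
      have : Pi.single i 1 ∈ (P.restrictScalars k).comap Λ := hPt ▸ trivial
      simpa [Λ] using this
    have hf : f ∈ J := by
      rw [← hsat]
      refine ⟨1, fun g hg => ?_⟩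
      rw [pow_one] at hg
      have := hmP hg
      rw [hy] at this
      rw [← Ideal.Quotient.eq_zero_iff_mem, map_mul]
      have h2 : g • (Ideal.Quotient.mk J f) = 0 := by simpa using this
      exact h2
    apply hPp.ne_top
    rw [Ideal.eq_top_iff_one, hy]
    have : Ideal.Quotient.mk J f = 0 := Ideal.Quotient.eq_zero_iff_mem.2 hf
    simp [this]
  have h := Subspace.biUnion_ne_univ_of_top_notMem hs
  obtain ⟨v, hv⟩ := (Set.ne_univ_iff_exists_notMem _).1 h
  refine ⟨Λ v, hΛ v, fun r => ⟨fun hr => ?_, fun hr => Ideal.mul_mem_right _ _ hr⟩⟩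
  by_contra hrJ
  have hmem : Λ v ∈ ⋃ p ∈ associatedPrimes (MvPolynomial (Fin d) k) M,
      (p : Set (MvPolynomial (Fin d) k)) := by
    rw [biUnion_associatedPrimes_eq_zero_divisors]
    refine ⟨Ideal.Quotient.mk J r, ?_, ?_⟩
    · rwa [Ne, Ideal.Quotient.eq_zero_iff_mem]
    · change Ideal.Quotient.mk J (Λ v * r) = 0
      rw [Ideal.Quotient.eq_zero_iff_mem, mul_comm]
      exact hr
  simp only [Set.mem_iUnion] at hmem hv
  obtain ⟨P, hP, hPv⟩ := hmem
  exact hv ⟨_, Finset.mem_image.2 ⟨P, by rwa [Set.Finite.mem_toFinset], rfl⟩, hPv⟩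
end Part6
section Part7
open CategoryTheory CategoryTheory.Abelian
variable {k : Type} [Field k] {d : ℕ}

lemma one_notMem_vars : (1 : MvPolynomial (Fin d) k) ∉ idealOfVars (Fin d) k := by
  intro h
  rw [← pow_one (idealOfVars (Fin d) k), mem_pow_idealOfVars_iff'] at h
  have h2 := h 0 (by simp)
  simp at h2

lemma sub_const_mem_vars (r : MvPolynomial (Fin d) k) :
    r - C (coeff 0 r) ∈ idealOfVars (Fin d) k := by
  rw [← pow_one (idealOfVars (Fin d) k), mem_pow_idealOfVars_iff']
  intro x hx
  have : x = 0 := by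
    rw [← Finsupp.degree_eq_zero_iff]; omega
  subst this
  simp

/-- a homogeneous socle element -/
lemma exists_socle {J : Ideal (MvPolynomial (Fin d) k)} (hJ : HC J)
    (hsat : sat (idealOfVars (Fin d) k) J ≠ J) :
    ∃ (f : MvPolynomial (Fin d) k) (j : ℕ), f.IsHomogeneous j ∧ f ∉ J ∧
      ∀ r, r * f ∈ J ↔ r ∈ idealOfVars (Fin d) k := by
  classical
  have h1 : ∃ g ∈ sat (idealOfVars (Fin d) k) J, g ∉ J := by
    by_contra! h
    exact hsat (le_antisymm h (le_sat _ _))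
  obtain ⟨g, hg, hgJ⟩ := h1
  have h2 : ∃ i, homogeneousComponent i g ∉ J := by
    by_contra! h
    apply hgJ
    rw [← sum_homogeneousComponent g]
    exact Submodule.sum_mem _ fun i _ => h i
  obtain ⟨i, hi⟩ := h2
  obtain ⟨N, hN⟩ := hJ.sat g hg i
  set f := homogeneousComponent i g with hf
  have hfi : f.IsHomogeneous i := homogeneousComponent_isHomogeneous i g
  have hex : ∃ N, ∀ g ∈ idealOfVars (Fin d) k ^ N, g * f ∈ J := ⟨N, hN⟩
  obtain ⟨N, hN, hmin⟩ : ∃ N, (∀ g ∈ idealOfVars (Fin d) k ^ N, g * f ∈ J) ∧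
      ∀ M < N, ¬ ∀ g ∈ idealOfVars (Fin d) k ^ M, g * f ∈ J :=
    ⟨Nat.find hex, Nat.find_spec hex, fun M hM => Nat.find_min hex hM⟩
  rcases N with _ | N
  · exact absurd (by simpa using hN 1 (by simp)) hi
  have h3 : ∃ s : Fin d →₀ ℕ, s.degree = N ∧ monomial s (1 : k) * f ∉ J := by
    by_contra! h
    apply hmin N (Nat.lt_succ_self N)
    intro g hg
    rw [pow_idealOfVars_eq_span] at hg
    have hle : Ideal.span ((fun x => monomial x (1 : k)) '' (Finsupp.degree ⁻¹' {N})) ≤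
        Submodule.comap (LinearMap.mulRight (MvPolynomial (Fin d) k) f) J := by
      rw [Ideal.span_le]
      rintro _ ⟨s, hs, rfl⟩
      exact h s hs
    exact hle hg
  obtain ⟨s, hs, hsf⟩ := h3
  have hsh : (monomial s (1 : k)).IsHomogeneous N := isHomogeneous_monomial _ hs
  refine ⟨monomial s 1 * f, N + i, hsh.mul hfi, hsf, fun r => ?_⟩
  have hback : ∀ r ∈ idealOfVars (Fin d) k, r * (monomial s 1 * f) ∈ J := by
    intro r hr
    rw [← mul_assoc]
    apply hN
    rw [pow_succ']
    exact Ideal.mul_mem_mul hr (hom_mem_pow_vars hsh le_rfl)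
  refine ⟨fun hr => ?_, hback r⟩
  by_cases hc : coeff 0 r = 0
  · have := sub_const_mem_vars r
    rwa [hc, C_0, sub_zero] at this
  · exfalso
    apply hsf
    have h4 := hback _ (sub_const_mem_vars r)
    have h5 := J.sub_mem hr h4
    have h6 := J.mul_mem_left (C (coeff 0 r)⁻¹) h5
    rw [← sub_mul, sub_sub_cancel, ← mul_assoc, ← C_mul, inv_mul_cancel₀ hc, C_1, one_mul] at h6
    exact h6

lemma sat_sup {R : Type*} [CommRing R] [IsNoetherianRing R] {J Q : Ideal R} {f : R}
    (hf : f ∈ sat J Q) : sat J (Q ⊔ Ideal.span {f}) = sat J Q := by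
  apply le_antisymm
  · rw [← sat_sat J Q]
    have h : Q ⊔ Ideal.span {f} ≤ sat J Q :=
      sup_le (le_sat _ _) ((Ideal.span_singleton_le_iff_mem _).2 hf)
    rintro g ⟨N, hN⟩
    rw [sat_sat]
    rw [← sat_sat]
    exact ⟨N, fun r hr => h (hN r hr)⟩
  · rintro g ⟨N, hN⟩
    exact ⟨N, fun r hr => Ideal.mem_sup_left (hN r hr)⟩

/-- additivity of the `H0` side along a socle element -/
lemma H0_socle {J : Ideal (MvPolynomial (Fin d) k)} {f : MvPolynomial (Fin d) k}
    (h : ∀ r, r * f ∈ J ↔ r ∈ idealOfVars (Fin d) k) :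
    kr k d (H0 (M := MvPolynomial (Fin d) k ⧸ J) (idealOfVars (Fin d) k)) =
      kr k d (H0 (M := MvPolynomial (Fin d) k ⧸ (J ⊔ Ideal.span {f})) (idealOfVars (Fin d) k)) +
      kr k d (MvPolynomial (Fin d) k ⧸ idealOfVars (Fin d) k) := by
  have hfs : f ∈ sat (idealOfVars (Fin d) k) J :=
    ⟨1, fun g hg => (h g).2 (by simpa using hg)⟩
  let α : (MvPolynomial (Fin d) k ⧸ idealOfVars (Fin d) k) →ₗ[MvPolynomial (Fin d) k]
      H0 (M := MvPolynomial (Fin d) k ⧸ J) (idealOfVars (Fin d) k) :=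
    (mulQ _ J f h).codRestrict _ (by
      intro y
      obtain ⟨r, rfl⟩ := Ideal.Quotient.mk_surjective y
      rw [mulQ_mk, mk_mem_H0]
      exact Ideal.mul_mem_left _ _ hfs)
  let β : H0 (M := MvPolynomial (Fin d) k ⧸ J) (idealOfVars (Fin d) k) →ₗ[MvPolynomial (Fin d) k]
      H0 (M := MvPolynomial (Fin d) k ⧸ (J ⊔ Ideal.span {f})) (idealOfVars (Fin d) k) :=
    (facQ J f).restrict (by
      intro y hy
      obtain ⟨r, rfl⟩ := Ideal.Quotient.mk_surjective y
      rw [facQ_mk, mk_mem_H0, sat_sup hfs]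
      rwa [mk_mem_H0] at hy)
  refine kr_exact α β ?_ ?_ ?_
  · intro a b hab
    exact mulQ_inj _ _ _ h (congrArg Subtype.val hab)
  · rintro ⟨y, hy⟩
    obtain ⟨r, rfl⟩ := Ideal.Quotient.mk_surjective y
    rw [mk_mem_H0, sat_sup hfs, ← mk_mem_H0] at hy
    exact ⟨⟨_, hy⟩, rfl⟩
  · rintro ⟨y, hy⟩
    have h1 := mulQ_exact _ J f h y
    constructor
    · intro h2
      obtain ⟨z, hz⟩ := h1.1 (congrArg Subtype.val h2)
      exact ⟨z, Subtype.ext hz⟩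
    · rintro ⟨z, hz⟩
      exact Subtype.ext (h1.2 ⟨z, congrArg Subtype.val hz⟩)

theorem main_claim [Infinite k] (hd : 0 < d) (J : Ideal (MvPolynomial (Fin d) k)) (hJ : HC J) :
    (∀ i, d < i → Subsingleton (EX (MvPolynomial (Fin d) k) (MvPolynomial (Fin d) k ⧸ J) i)) ∧
    kr k d (EX (MvPolynomial (Fin d) k) (MvPolynomial (Fin d) k ⧸ J) d) =
      kr k d (H0 (M := MvPolynomial (Fin d) k ⧸ J) (idealOfVars (Fin d) k)) := by
  induction J using WellFoundedGT.induction with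
  | ind J ih =>
  by_cases htop : J = ⊤
  · subst htop
    have : Subsingleton (MvPolynomial (Fin d) k ⧸ (⊤ : Ideal (MvPolynomial (Fin d) k))) :=
      Ideal.Quotient.subsingleton_iff.2 rfl
    refine ⟨fun i _ => EX_subsingleton_of_subsingleton i, ?_⟩
    have := EX_subsingleton_of_subsingleton (R := MvPolynomial (Fin d) k)
      (M := MvPolynomial (Fin d) k ⧸ (⊤ : Ideal (MvPolynomial (Fin d) k))) d
    rw [kr_subsingleton, kr_subsingleton]
  by_cases hsat : sat (idealOfVars (Fin d) k) J = J
  · obtain ⟨x, hx1, hx⟩ := exists_linear_nzd hsat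
    have hxm : x ∈ idealOfVars (Fin d) k := by
      simpa using hom_mem_pow_vars hx1 (le_refl 1)
    have hxJ : x ∉ J := by
      intro h
      apply htop
      rw [Ideal.eq_top_iff_one, ← hx, one_mul]
      exact h
    have hlt : J < J ⊔ Ideal.span {x} := by
      refine lt_of_le_of_ne le_sup_left fun h => hxJ ?_
      rw [h]
      exact Ideal.mem_sup_right (Ideal.mem_span_singleton_self x)
    obtain ⟨ih1, -⟩ := ih _ hlt (hJ.sup (HC.span_singleton hx1))
    obtain ⟨h2, h0, δ, h1, h3⟩ := les (mulQ J J x hx) (facQ J x) (mulQ_inj _ _ _ _)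
      (facQ_surj _ _) (mulQ_exact _ _ _ _)
    have hv : ∀ i, d ≤ i →
        Subsingleton (EX (MvPolynomial (Fin d) k) (MvPolynomial (Fin d) k ⧸ J) i) := by
      intro i hi
      refine vanish hJ i x hxm fun e => ?_
      have := ih1 (i + 1) (by omega)
      obtain ⟨e', he'⟩ := (h1 i e).1 (Subsingleton.elim _ _)
      refine ⟨e', ?_⟩
      rwa [mulQ_self, pre_smul_id] at he'
    refine ⟨fun i hi => hv i hi.le, ?_⟩
    have := hv d le_rfl
    have hH : Subsingleton (H0 (M := MvPolynomial (Fin d) k ⧸ J) (idealOfVars (Fin d) k)) := by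
      refine subsingleton_of_forall_eq 0 fun y => ?_
      obtain ⟨y, hy⟩ := y
      obtain ⟨r, rfl⟩ := Ideal.Quotient.mk_surjective y
      have hy' := hy
      rw [mk_mem_H0, hsat] at hy'
      exact Subtype.ext (Ideal.Quotient.eq_zero_iff_mem.2 hy')
    rw [kr_subsingleton, kr_subsingleton]
  · obtain ⟨f, j, hfj, hfJ, hf⟩ := exists_socle hJ hsat
    have hlt : J < J ⊔ Ideal.span {f} := by
      refine lt_of_le_of_ne le_sup_left fun h => hfJ ?_
      rw [h]
      exact Ideal.mem_sup_right (Ideal.mem_span_singleton_self f)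
    obtain ⟨ih1, ih2⟩ := ih _ hlt (hJ.sup (HC.span_singleton hfj))
    obtain ⟨h2, h0, δ, h1, h3⟩ := les (mulQ _ J f hf) (facQ J f) (mulQ_inj _ _ _ _)
      (facQ_surj _ _) (mulQ_exact _ _ _ _)
    obtain ⟨hK, ⟨θ⟩⟩ := kc_vars (k := k) (d := d)
    refine ⟨fun i hi => ?_, ?_⟩
    · refine subsingleton_of_forall_eq 0 fun e => ?_
      have := hK i (by omega)
      have := ih1 i hi
      obtain ⟨e', rfl⟩ := (h2 i e).1 (Subsingleton.elim _ _)
      rw [Subsingleton.elim e' 0, map_zero]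
    · rw [H0_socle hf, ← ih2, ← kr_congr θ, add_comm]
      refine kr_exact (pre (facQ J f) d) (pre (mulQ _ J f hf) d) ?_ ?_ (h2 d)
      · obtain ⟨c, rfl⟩ := Nat.exists_eq_add_of_lt hd
        have hc : 0 + c + 1 = c + 1 := by omega
        rw [injective_iff_map_eq_zero]
        intro e he
        have := hK (0 + c) (by omega)
        obtain ⟨e', rfl⟩ := (h3 (0 + c) e).1 he
        rw [Subsingleton.elim e' 0, map_zero]
      · intro e
        have := ih1 (d + 1) (by omega)
        exact (h1 d e).1 (Subsingleton.elim _ _)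
end Part7
section Part8
open CategoryTheory CategoryTheory.Abelian

lemma ext_compare {R : Type} [CommRing R] (A Y : ModuleCat.{0} R) (p : ℕ) :
    Nonempty ((((Ext R (ModuleCat R) (p + 1)).obj (Opposite.op A)).obj Y) ≃ₗ[R]
      Abelian.Ext A Y (p + 1)) := by
  let P : ProjectiveResolution A := projectiveResolution A
  let K := P.complex.linearYonedaObj R Y
  let S : ShortComplex (ModuleCat R) := K.sc' p (p + 1) (p + 1 + 1)
  let i1 := P.isoExt (R := R) (p + 1) Y
  let i2 : K.homology (p + 1) ≅ S.homology :=
    ShortComplex.homologyMapIso (K.isoSc' p (p + 1) (p + 1 + 1) (by simp) (by simp))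
  let i3 := S.moduleCatHomologyIso
  have hmem : ∀ f : (P.complex.X (p + 1) ⟶ Y),
      S.g.hom f = 0 ↔ P.complex.d (p + 1 + 1) (p + 1) ≫ f = 0 := fun f => Iff.rfl
  have hsm : ∀ (r : R) (f : P.complex.X (p + 1) ⟶ Y)
      (hf : P.complex.d (p + 1 + 1) (p + 1) ≫ f = 0),
      P.extMk (r • f) (p + 1 + 1) rfl (by rw [Linear.comp_smul, hf, smul_zero]) =
        r • P.extMk f (p + 1 + 1) rfl hf := by
    intro r f hf
    rw [Ext.smul_eq_comp_mk₀, P.extMk_comp_mk₀]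
    congr 1
  let φ : LinearMap.ker S.g.hom →ₗ[R] Abelian.Ext A Y (p + 1) :=
    { toFun := fun f => P.extMk (f.1 : P.complex.X (p + 1) ⟶ Y) (p + 1 + 1) rfl f.2
      map_add' := fun f g => (P.add_extMk _ _ _ _ _ _).symm
      map_smul' := fun r f =>
        hsm r f.1 f.2 }
  have hφ : Function.Surjective φ := by
    intro α
    obtain ⟨f, hf, rfl⟩ := P.extMk_surjective α (p + 1 + 1) rfl
    exact ⟨⟨f, hf⟩, rfl⟩
  have hker : LinearMap.ker φ = LinearMap.range S.moduleCatToCycles := by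
    ext ⟨f, hf⟩
    rw [LinearMap.mem_ker]
    refine (P.extMk_eq_zero_iff f (p + 1 + 1) rfl hf p rfl).trans ?_
    constructor
    · rintro ⟨g, hg⟩
      exact ⟨g, Subtype.ext hg⟩
    · rintro ⟨g, hg⟩
      exact ⟨g, congrArg Subtype.val hg⟩
  exact ⟨((i1 ≪≫ i2 ≪≫ i3).toLinearEquiv).trans
    ((Submodule.quotEquivOfEq _ _ hker.symm).trans (φ.quotKerEquivOfSurjective hφ))⟩

variable {k : Type} [Field k] {d : ℕ}

lemma kLength_eq (A : ModuleCat.{0} (MvPolynomial (Fin d) k)) :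
    kLength k A = (kr k d A).toNat := rfl

lemma finrank_eq_kr (J Q : Ideal (MvPolynomial (Fin d) k)) :
    Module.finrank k (H0 (M := MvPolynomial (Fin d) k ⧸ Q) J) =
      (kr k d (H0 (M := MvPolynomial (Fin d) k ⧸ Q) J)).toNat := by
  unfold kr Module.finrank
  congr 2
  ext c x
  exact congrArg Subtype.val (algebraMap_smul (MvPolynomial (Fin d) k) c x).symm

lemma kLength_ext [Infinite k] (hd : 0 < d) (J : Ideal (MvPolynomial (Fin d) k)) (hJ : HC J) :
    kLength k (((Ext (MvPolynomial (Fin d) k) (ModuleCat (MvPolynomial (Fin d) k)) d).obj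
      (Opposite.op (ModuleCat.of _ (MvPolynomial (Fin d) k ⧸ J)))).obj
        (ModuleCat.of _ (MvPolynomial (Fin d) k))) =
      Module.finrank k (H0 (M := MvPolynomial (Fin d) k ⧸ J) (idealOfVars (Fin d) k)) := by
  rw [finrank_eq_kr, ← (main_claim hd J hJ).2, kLength_eq]
  congr 1
  obtain ⟨p, hp⟩ : ∃ p, d = p + 1 := ⟨d - 1, by omega⟩
  have : ∀ n, n = p + 1 →
    kr k d (((Ext (MvPolynomial (Fin d) k) (ModuleCat (MvPolynomial (Fin d) k)) n).obj
      (Opposite.op (ModuleCat.of _ (MvPolynomial (Fin d) k ⧸ J)))).obj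
        (ModuleCat.of _ (MvPolynomial (Fin d) k))) =
    kr k d (EX (MvPolynomial (Fin d) k) (MvPolynomial (Fin d) k ⧸ J) n) := by
    rintro _ rfl
    obtain ⟨e⟩ := ext_compare (ModuleCat.of (MvPolynomial (Fin d) k) (MvPolynomial (Fin d) k ⧸ J))
      (ModuleCat.of _ (MvPolynomial (Fin d) k)) p
    exact kr_congr e
  exact this d hp
end Part8

theorem statement0 (k : Type) [Field k] [CharZero k] (d : ℕ) (hd : 1 < d)
    (I : Ideal (MvPolynomial (Fin d) k))
    (hI : I.IsHomogeneous (homogeneousSubmodule (Fin d) k))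
    (m : Ideal (MvPolynomial (Fin d) k))
    (hm : m = Ideal.span (Set.range (X : Fin d → MvPolynomial (Fin d) k))) :
    ∃ L : ℝ,
      Tendsto (fun n : ℕ =>
          (Module.finrank k (H0 (M := MvPolynomial (Fin d) k ⧸ I ^ n) m) : ℝ) / (n : ℝ) ^ d)
        atTop (nhds L) ∧
      Tendsto (fun n : ℕ =>
          (kLength k (((Ext (MvPolynomial (Fin d) k) (ModuleCat (MvPolynomial (Fin d) k)) d).obj
              (Opposite.op (ModuleCat.of _ (MvPolynomial (Fin d) k ⧸ I ^ n)))).obj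
            (ModuleCat.of _ (MvPolynomial (Fin d) k))) : ℝ) / (n : ℝ) ^ d)
        atTop (nhds L) := by
  subst hm
  have hH := hc_of_isHomogeneous hI
  obtain ⟨L, hL⟩ := H0_limit (by omega : 0 < d) hH
  refine ⟨L, hL, hL.congr fun n => ?_⟩
  rw [kLength_ext (by omega : 0 < d) (I ^ n) (hH.pow n)]
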